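/- arXiv:1709.06168 — 2 statements merged into one kernel-verified Lean document; each statement's English description precedes it below -/
import Mathlib

section
/- For every ε > 0 there is a constant A_ε such that the following holds. Let q be an odd prime, let B ≥ 2 be a real number, and let m be an integer with 1 ≤ m ≤ q/4 such that m is a multiple of every natural number n ≤ B. Then (1/q) Σ_{k=0}^{q−1} |C(k) − C(k+m)|² ≤ A_ε (B^{−1+ε} + (m/q) log B). -/
open scoped Classical Real
open Complex MeasureTheory

/-- The sawtooth function `ψ`. -/
noncomputable def saw (x : ℝ) : ℝ := if Int.fract x = 0 then 0 else Int.fract x - 1/2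

/-- The Euler product `A_{q,χ}`. -/
noncomputable def Aq (q : ℕ) (χ : DirichletCharacter ℂ q) : ℂ :=
  ∏' p : Nat.Primes, if (p : ℕ) ∣ q then 1 else
    1 - (1 - χ ((p : ℕ) : ZMod q)) ^ 2 / (((p : ℕ) : ℂ) - 1) ^ 2

/-- The quantity `C(k) = C(k; q)` (a real number; we take the real part of the
defining expression, which is real). -/
noncomputable def Cfun (q : ℕ) (k : ℤ) : ℝ :=
  if h : q = 0 then 0 else
    haveI : NeZero q := ⟨h⟩
    ((↑q.totient : ℂ)⁻¹ *
      ∑ χ ∈ Finset.univ.filter (fun χ : DirichletCharacter ℂ q => χ ≠ 1),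
        (starRingEnd ℂ) (χ ((k : ZMod q))) * DirichletCharacter.LFunction χ 0 *
          DirichletCharacter.LFunction χ 1 * Aq q χ).re

section DirichletSeries

open Filter Topology Finset

lemma sum_range_mul_zmod {q : ℕ} [NeZero q] {M : Type*} [AddCommMonoid M] (f : ℕ → M) (J : ℕ) :
    ∑ n ∈ range (q * J), f n = ∑ j ∈ range J, ∑ x : ZMod q, f (q * j + x.val) := by
  induction J with
  | zero => simp
  | succ J ih =>
    rw [Nat.mul_succ, sum_range_add, ih, sum_range_succ]
    congr 1
    refine sum_bij' (fun n _ => (n : ZMod q)) (fun x _ => x.val) ?_ ?_ ?_ ?_ ?_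
    · simp
    · intro x _; simpa using ZMod.val_lt x
    · intro n hn; exact ZMod.val_cast_of_lt (by simpa using hn)
    · intro x _; simp
    · intro n hn; rw [ZMod.val_cast_of_lt (by simpa using hn)]

lemma norm_partial_sum_sub_le {q : ℕ} [NeZero q] {Φ : ZMod q → ℂ} (h0 : ∑ x, Φ x = 0)
    (h1 : ∀ x, ‖Φ x‖ ≤ 1) {s : ℝ} (hs : 0 < s) {J K : ℕ} (hJ : 1 ≤ J) (hK : J ≤ K) :
    ‖∑ n ∈ range (q * K), Φ n * ((n : ℝ) ^ (-s) : ℝ)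
      - ∑ n ∈ range (q * J), Φ n * ((n : ℝ) ^ (-s) : ℝ)‖
      ≤ q * (((q * J : ℕ) : ℝ) ^ (-s) - ((q * K : ℕ) : ℝ) ^ (-s)) := by
  have hq : 0 < q := NeZero.pos q
  induction K, hK using Nat.le_induction with
  | base => simp
  | succ K hK ih =>
    have hK0 : 0 < q * K := Nat.mul_pos hq (by omega)
    have hblock : ‖∑ x : ZMod q, Φ ((q * K + x.val : ℕ) : ZMod q)
        * (((q * K + x.val : ℕ) : ℝ) ^ (-s) : ℝ)‖
        ≤ q * (((q * K : ℕ) : ℝ) ^ (-s) - ((q * (K + 1) : ℕ) : ℝ) ^ (-s)) := by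
      have e : ∑ x : ZMod q, Φ ((q * K + x.val : ℕ) : ZMod q)
          * (((q * K + x.val : ℕ) : ℝ) ^ (-s) : ℝ)
          = ∑ x : ZMod q, Φ x * (((((q * K + x.val : ℕ) : ℝ) ^ (-s)
            - ((q * K : ℕ) : ℝ) ^ (-s) : ℝ)) : ℂ) := by
        have : ∑ x : ZMod q, Φ x * (((((q * K : ℕ) : ℝ) ^ (-s) : ℝ)) : ℂ) = 0 := by
          rw [← sum_mul, h0, zero_mul]
        rw [← sub_zero (∑ x : ZMod q, Φ ((q * K + x.val : ℕ) : ZMod q) * _), ← this,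
          ← sum_sub_distrib]
        refine sum_congr rfl fun x _ => ?_
        push_cast
        simp
        ring
      rw [e]
      refine (norm_sum_le _ _).trans ?_
      have : ∀ x ∈ (univ : Finset (ZMod q)), ‖Φ x * (((((q * K + x.val : ℕ) : ℝ) ^ (-s)
            - ((q * K : ℕ) : ℝ) ^ (-s) : ℝ)) : ℂ)‖
          ≤ ((q * K : ℕ) : ℝ) ^ (-s) - ((q * (K + 1) : ℕ) : ℝ) ^ (-s) := by
        intro x _
        rw [norm_mul, norm_real, Real.norm_eq_abs, abs_sub_comm]
        have hx : q * K + x.val ≤ q * (K + 1) := by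
          have := ZMod.val_lt x
          rw [Nat.mul_succ]; omega
        have a1 : ((q * K + x.val : ℕ) : ℝ) ^ (-s) ≤ ((q * K : ℕ) : ℝ) ^ (-s) :=
          Real.rpow_le_rpow_of_nonpos (by exact_mod_cast hK0) (by exact_mod_cast Nat.le_add_right _ _)
            (by linarith)
        have a2 : ((q * (K + 1) : ℕ) : ℝ) ^ (-s) ≤ ((q * K + x.val : ℕ) : ℝ) ^ (-s) :=
          Real.rpow_le_rpow_of_nonpos (by exact_mod_cast (by omega : 0 < q * K + x.val))
            (by exact_mod_cast hx) (by linarith)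
        rw [abs_of_nonneg (by linarith)]
        calc _ ≤ 1 * _ := mul_le_mul_of_nonneg_right (h1 x) (by linarith)
          _ ≤ _ := by linarith
      refine (sum_le_card_nsmul _ _ _ this).trans ?_
      simp [ZMod.card]
    have e2 : ∑ n ∈ range (q * (K + 1)), Φ n * ((n : ℝ) ^ (-s) : ℝ)
        = ∑ n ∈ range (q * K), Φ n * ((n : ℝ) ^ (-s) : ℝ)
          + ∑ x : ZMod q, Φ ((q * K + x.val : ℕ) : ZMod q)
            * (((q * K + x.val : ℕ) : ℝ) ^ (-s) : ℝ) := by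
      rw [sum_range_mul_zmod, sum_range_mul_zmod, sum_range_succ]
    rw [e2, add_sub_right_comm]
    refine (norm_add_le _ _).trans ((add_le_add ih hblock).trans (le_of_eq ?_))
    ring

lemma norm_LFunction_sub_partial_sum_le {q : ℕ} [NeZero q] {Φ : ZMod q → ℂ} (h0 : ∑ x, Φ x = 0)
    (h1 : ∀ x, ‖Φ x‖ ≤ 1) {s : ℝ} (hs : 1 < s) {J : ℕ} (hJ : 1 ≤ J) :
    ‖ZMod.LFunction Φ s - ∑ n ∈ range (q * J), Φ n * ((n : ℝ) ^ (-s) : ℝ)‖ ≤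
      q * ((q * J : ℕ) : ℝ) ^ (-s) := by
  have hq : 0 < q := NeZero.pos q
  have hre : 1 < (s : ℂ).re := by simpa using hs
  have hsum := (ZMod.LSeriesSummable_of_one_lt_re Φ hre).hasSum
  have key : ∀ n : ℕ, LSeries.term (fun n => Φ n) s n = Φ n * ((n : ℝ) ^ (-s) : ℝ) := by
    intro n
    rcases eq_or_ne n 0 with rfl | hn
    · simp [Real.zero_rpow (by linarith : -s ≠ 0)]
    · rw [LSeries.term_of_ne_zero hn, Complex.ofReal_cpow (by positivity)]
      push_cast
      rw [Complex.cpow_neg, div_eq_mul_inv]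
  have htend : Tendsto (fun K : ℕ => ∑ n ∈ range (q * K), Φ n * (((n : ℝ) ^ (-s) : ℝ) : ℂ)) atTop
      (𝓝 (ZMod.LFunction Φ s)) := by
    rw [ZMod.LFunction_eq_LSeries Φ hre, LSeries]
    have := hsum.tendsto_sum_nat
    simp only [key] at this
    rw [tsum_congr key]
    exact this.comp (tendsto_id.const_mul_atTop' hq)
  have := ((htend.sub_const (∑ n ∈ range (q * J), Φ n * (((n : ℝ) ^ (-s) : ℝ) : ℂ))).norm)
  refine le_of_tendsto this ?_
  filter_upwards [eventually_ge_atTop J] with K hK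
  refine (norm_partial_sum_sub_le h0 h1 (by linarith) hJ hK).trans ?_
  gcongr
  have : 0 ≤ ((q * K : ℕ) : ℝ) ^ (-s) := by positivity
  linarith

lemma norm_LFunction_one_sub_partial_sum_le {q : ℕ} [NeZero q] {Φ : ZMod q → ℂ}
    (h0 : ∑ x, Φ x = 0) (h1 : ∀ x, ‖Φ x‖ ≤ 1) {J : ℕ} (hJ : 1 ≤ J) :
    ‖ZMod.LFunction Φ 1 - ∑ n ∈ range (q * J), Φ n / n‖ ≤ 1 / J := by
  have hq : 0 < q := NeZero.pos q
  have hqJ : (0 : ℝ) < ((q * J : ℕ) : ℝ) := by exact_mod_cast Nat.mul_pos hq hJ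
  have c1 : Tendsto (fun s : ℝ => ZMod.LFunction Φ (s : ℂ)) (𝓝[>] 1) (𝓝 (ZMod.LFunction Φ 1)) := by
    have : ContinuousAt (fun s : ℝ => ZMod.LFunction Φ (s : ℂ)) 1 :=
      ((ZMod.differentiable_LFunction_of_sum_zero h0).continuous.comp
        Complex.continuous_ofReal).continuousAt
    have h := this.tendsto
    rw [Complex.ofReal_one] at h
    exact h.mono_left nhdsWithin_le_nhds
  have hpow : ∀ n : ℕ, Tendsto (fun s : ℝ => (n : ℝ) ^ (-s)) (𝓝[>] 1) (𝓝 ((n : ℝ) ^ (-1 : ℝ))) := by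
    intro n
    have : ContinuousAt (fun s : ℝ => (n : ℝ) ^ (-s)) 1 := by
      rcases eq_or_ne n 0 with rfl | hn
      · refine ContinuousAt.congr (f := fun _ => 0) continuousAt_const ?_
        filter_upwards [eventually_gt_nhds (zero_lt_one' ℝ)] with s hs
        simp [Real.zero_rpow (by linarith : -s ≠ 0)]
      · exact (Real.continuousAt_const_rpow (by positivity)).comp continuousAt_neg
    exact this.tendsto.mono_left nhdsWithin_le_nhds
  have c2 : Tendsto (fun s : ℝ => ∑ n ∈ range (q * J), Φ n * (((n : ℝ) ^ (-s) : ℝ) : ℂ)) (𝓝[>] 1)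
      (𝓝 (∑ n ∈ range (q * J), Φ n / n)) := by
    refine tendsto_finsetSum _ fun n _ => ?_
    rw [div_eq_mul_inv]
    have h := (Complex.continuous_ofReal.tendsto _).comp (hpow n)
    rw [Real.rpow_neg_one] at h
    push_cast at h
    exact h.const_mul _
  have c3 : Tendsto (fun s : ℝ => (q : ℝ) * ((q * J : ℕ) : ℝ) ^ (-s)) (𝓝[>] 1) (𝓝 (1 / J)) := by
    have h := (hpow (q * J)).const_mul (q : ℝ)
    rw [Real.rpow_neg_one] at h
    convert h using 2
    push_cast
    field_simp
  refine le_of_tendsto_of_tendsto (c1.sub c2).norm c3 ?_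
  filter_upwards [self_mem_nhdsWithin] with s hs
  exact norm_LFunction_sub_partial_sum_le h0 h1 hs hJ

end DirichletSeries

section ValueAtZero

open Filter Topology Finset ZMod HurwitzZeta

lemma tendsto_partial_sum_LFunction_one {q : ℕ} [NeZero q] {Φ : ZMod q → ℂ}
    (h0 : ∑ x, Φ x = 0) (h1 : ∀ x, ‖Φ x‖ ≤ 1) :
    Tendsto (fun N : ℕ => ∑ n ∈ range N, Φ n / n) atTop (𝓝 (ZMod.LFunction Φ 1)) := by
  have hq : 0 < q := NeZero.pos q
  have hdiv : Tendsto (fun N : ℕ => N / q) atTop atTop := Nat.tendsto_div_const_atTop hq.ne'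
  have hlim : Tendsto (fun N : ℕ => 2 / ((N / q : ℕ) : ℝ)) atTop (𝓝 0) :=
    (tendsto_const_div_atTop_nhds_zero_nat (2 : ℝ)).comp hdiv
  rw [tendsto_iff_norm_sub_tendsto_zero]
  refine squeeze_zero' (Eventually.of_forall fun _ => norm_nonneg _) ?_ hlim
  filter_upwards [hdiv.eventually_ge_atTop 1] with N hN
  set J := N / q
  have hJ : (0 : ℝ) < J := by exact_mod_cast hN
  have hle : q * J ≤ N := Nat.mul_div_le N q
  have hlt : N - q * J ≤ q := by
    have h2 : N - q * J = N % q := Nat.sub_eq_of_eq_add (Nat.mod_add_div N q).symm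
    exact h2 ▸ (Nat.mod_lt N hq).le
  have hA := norm_LFunction_one_sub_partial_sum_le h0 h1 hN
  have hB : ‖∑ n ∈ Ico (q * J) N, Φ n / n‖ ≤ 1 / J := by
    refine (norm_sum_le_of_le _ (f := fun n : ℕ => Φ n / n)
      (n := fun _ => 1 / ((q : ℝ) * J)) fun n hn => ?_).trans ?_
    · have h2 : (q : ℝ) * J ≤ n := by exact_mod_cast (mem_Ico.1 hn).1
      have h3 : (0 : ℝ) < q * J := by positivity
      rw [norm_div, Complex.norm_natCast]
      exact div_le_div₀ zero_le_one (h1 _) h3 h2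
    · rw [sum_const, Nat.card_Ico, nsmul_eq_mul]
      have : ((N - q * J : ℕ) : ℝ) ≤ q := by exact_mod_cast hlt
      calc _ ≤ (q : ℝ) * (1 / (q * J)) := by gcongr
        _ = 1 / J := by field_simp
  rw [← sum_range_add_sum_Ico _ hle, norm_sub_rev]
  calc _ = ‖(ZMod.LFunction Φ 1 - ∑ n ∈ range (q * J), Φ n / n)
      - ∑ n ∈ Ico (q * J) N, Φ n / n‖ := by congr 1; ring
    _ ≤ 1 / J + 1 / J := (norm_sub_le _ _).trans (add_le_add hA hB)
    _ = 2 / J := by ring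

lemma one_sub_mem_slitPlane {z : ℂ} (hz : ‖z‖ = 1) (h : z ≠ 1) : 1 - z ∈ slitPlane := by
  left
  have h2 : z.re ≤ 1 := hz ▸ Complex.re_le_norm z
  have h3 : z.re ≠ 1 := by
    intro h3
    have h4 : z.re ^ 2 + z.im ^ 2 = 1 := by
      have := Complex.sq_norm z
      rw [hz, Complex.normSq_apply] at this
      nlinarith
    apply h
    apply Complex.ext
    · simpa using h3
    · have : z.im ^ 2 = 0 := by rw [h3] at h4; linarith
      simpa using this
  simp only [Complex.sub_re, Complex.one_re]
  exact sub_pos.2 (lt_of_le_of_ne h2 h3)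

lemma expZeta_one_eq_neg_log {q : ℕ} [NeZero q] {j : ZMod q} (hj : j ≠ 0) :
    expZeta (toAddCircle j) 1 = -Complex.log (1 - stdAddChar j) := by
  set z : ℂ := stdAddChar j
  have hz : ‖z‖ = 1 := by simp [z]
  have hz1 : z ≠ 1 := by
    intro h
    exact hj (injective_stdAddChar (by simpa [z] using h))
  have h0 : ∑ x : ZMod q, (stdAddChar (j * x) : ℂ) = 0 := by
    have := AddChar.sum_mulShift j (isPrimitive_stdAddChar q)
    simp only [hj, if_false, Nat.cast_zero] at this
    rw [← this]
    exact sum_congr rfl fun x _ => by rw [mul_comm]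
  rw [← LFunction_stdAddChar_eq_expZeta j 1 (Or.inl hj)]
  have hconv := tendsto_partial_sum_LFunction_one h0 (fun x => by simp)
  have hpow : ∀ n : ℕ, (stdAddChar (j * (n : ZMod q)) : ℂ) = z ^ n := by
    intro n
    rw [mul_comm, ← nsmul_eq_mul, AddChar.map_nsmul_eq_pow]
  simp only [hpow] at hconv
  have habel := Complex.tendsto_tsum_powerSeries_nhdsWithin_lt hconv
  rw [tendsto_map'_iff] at habel
  have hlog : Tendsto (fun x : ℝ => -Complex.log (1 - z * x)) (𝓝[<] 1)
      (𝓝 (-Complex.log (1 - z))) := by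
    have hc : ContinuousAt (fun x : ℝ => -Complex.log (1 - z * x)) 1 := by
      refine (ContinuousAt.clog ?_ ?_).neg
      · fun_prop
      · simpa using one_sub_mem_slitPlane hz hz1
    have := hc.tendsto
    simp only [Complex.ofReal_one, mul_one] at this
    exact this.mono_left nhdsWithin_le_nhds
  refine tendsto_nhds_unique_of_eventuallyEq habel hlog ?_
  filter_upwards [Ioo_mem_nhdsLT (zero_lt_one' ℝ)] with x hx
  have hx1 : ‖z * x‖ < 1 := by
    rw [norm_mul, hz, one_mul, norm_real, Real.norm_eq_abs, abs_of_pos hx.1]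
    exact hx.2
  rw [← (Complex.hasSum_taylorSeries_neg_log hx1).tsum_eq]
  simp only [Function.comp]
  refine tsum_congr fun n => ?_
  rw [mul_pow]; ring

/-- The periodic sawtooth function `1/2 - x/q` on `ℤ/qℤ`, vanishing at `0`. -/
noncomputable def zsaw (q : ℕ) (x : ZMod q) : ℝ := if x = 0 then 0 else 1 / 2 - (x.val : ℝ) / q

lemma zsaw_neg {q : ℕ} [NeZero q] (x : ZMod q) : zsaw q (-x) = -zsaw q x := by
  have hq : (q : ℝ) ≠ 0 := NeZero.ne _
  rcases eq_or_ne x 0 with rfl | hx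
  · simp [zsaw]
  · have : NeZero x := ⟨hx⟩
    rw [zsaw, zsaw, if_neg (neg_ne_zero.2 hx), if_neg hx, ZMod.val_neg_of_ne_zero,
      Nat.cast_sub (ZMod.val_lt x).le]
    field_simp
    ring

lemma abs_zsaw_le {q : ℕ} [NeZero q] (x : ZMod q) : |zsaw q x| ≤ 1 / 2 := by
  have hq : (0 : ℝ) < q := by exact_mod_cast NeZero.pos q
  unfold zsaw
  split_ifs
  · simp
  · have h : (x.val : ℝ) ≤ q := by exact_mod_cast (ZMod.val_lt x).le
    have h1 : (x.val : ℝ) / q ≤ 1 := (div_le_one hq).2 h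
    have h2 : 0 ≤ (x.val : ℝ) / q := by positivity
    rw [abs_le]; constructor <;> linarith

lemma sinZeta_one_eq {q : ℕ} [NeZero q] (j : ZMod q) :
    sinZeta (toAddCircle j) 1 = π * zsaw q j := by
  rcases eq_or_ne j 0 with rfl | hj
  · simp [zsaw]
    have := sinZeta_neg (0 : UnitAddCircle) 1
    rw [neg_zero] at this
    linear_combination (1 / 2 : ℂ) * this
  have hq : (0 : ℝ) < q := by exact_mod_cast NeZero.pos q
  set t : ℝ := (j.val : ℝ) / q with ht
  have ht0 : 0 < t := by
    have : 0 < j.val := Nat.pos_of_ne_zero (by simpa using hj)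
    positivity
  have ht1 : t < 1 := (div_lt_one hq).2 (by exact_mod_cast ZMod.val_lt j)
  have hz : (stdAddChar j : ℂ) = Complex.exp (2 * π * t * I) := by
    rw [stdAddChar_apply, toCircle_apply]
    congr 1
    push_cast [ht]
    ring
  have hsin : 0 < Real.sin (π * t) := Real.sin_pos_of_pos_of_lt_pi (by positivity)
    (by nlinarith [Real.pi_pos])
  have harg : (1 - stdAddChar j : ℂ).arg = π * t - π / 2 := by
    have : (1 - stdAddChar j : ℂ) = ((2 * Real.sin (π * t) : ℝ) : ℂ) *
        (Complex.cos ((π * t - π / 2 : ℝ)) + Complex.sin ((π * t - π / 2 : ℝ)) * I) := by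
      rw [hz]
      push_cast
      rw [Complex.cos_sub_pi_div_two, Complex.sin_sub_pi_div_two,
        show (2 * π * t * I : ℂ) = ((2 * (π * t) : ℂ)) * I by ring, Complex.exp_mul_I,
        Complex.cos_two_mul, Complex.sin_two_mul]
      have := Complex.sin_sq_add_cos_sq (π * t : ℂ)
      linear_combination (-2 : ℂ) * this
    rw [this]
    exact Complex.arg_mul_cos_add_sin_mul_I (by positivity)
      ⟨by nlinarith [Real.pi_pos], by nlinarith [Real.pi_pos]⟩
  rw [sinZeta_eq, ← map_neg, expZeta_one_eq_neg_log hj, expZeta_one_eq_neg_log (neg_ne_zero.2 hj)]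
  have hconj : (1 - stdAddChar (-j) : ℂ) = (starRingEnd ℂ) (1 - stdAddChar j) := by
    simp [AddChar.map_neg_eq_conj]
  rw [hconj, Complex.log_conj]
  · set w := Complex.log (1 - stdAddChar j)
    have him : w.im = π * t - π / 2 := by rw [← harg]; exact Complex.log_im _
    have : (starRingEnd ℂ) w = w - 2 * w.im * I := by
      apply Complex.ext <;> simp
      ring
    rw [this, him, zsaw, if_neg hj]
    push_cast [← ht]
    have hI : (I : ℂ) ≠ 0 := I_ne_zero
    field_simp
    ring_nf
  · rw [harg]; nlinarith [Real.pi_pos]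

lemma LFunction_zero_eq_sum {q : ℕ} [NeZero q] (hq : q ≠ 1) (χ : DirichletCharacter ℂ q) :
    DirichletCharacter.LFunction χ 0 = ∑ x, χ x * zsaw q x := by
  rcases χ.even_or_odd with h | h
  · rw [DirichletCharacter.LFunction, ZMod.LFunction_apply_zero_of_even h.to_fun, χ.map_zero' hq]
    have : ∑ x, χ x * (zsaw q x : ℂ) = -∑ x, χ x * (zsaw q x : ℂ) := by
      rw [← Finset.sum_neg_distrib]
      refine Fintype.sum_equiv (Equiv.neg _) _ _ fun x => ?_
      rw [Equiv.neg_apply, h.eval_neg, zsaw_neg]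
      push_cast
      ring
    linear_combination (-1 / 2 : ℂ) * this
  · rw [DirichletCharacter.LFunction, ZMod.LFunction_def_odd h.to_fun]
    simp only [neg_zero, cpow_zero, one_mul]
    refine sum_congr rfl fun x _ => ?_
    have := hurwitzZetaOdd_one_sub (toAddCircle x) (s := 1) (fun n hn => by
      have h2 := congrArg Complex.re hn
      simp at h2
      have : (0 : ℝ) ≤ n := n.cast_nonneg
      linarith)
    rw [sub_self, sinZeta_one_eq, Complex.Gamma_one, mul_one, mul_one, Complex.sin_pi_div_two,
      Complex.cpow_neg_one] at this
    rw [this]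
    have hpi : (π : ℂ) ≠ 0 := by exact_mod_cast Real.pi_ne_zero
    congr 1
    field_simp

end ValueAtZero

section CharacterEstimates

open Finset ZMod DirichletCharacter

lemma norm_gaussSum_sq {q : ℕ} [Fact q.Prime] {χ : DirichletCharacter ℂ q} (hχ : χ ≠ 1) :
    ‖gaussSum χ (stdAddChar : AddChar (ZMod q) ℂ)‖ ^ 2 = q := by
  have h := gaussSum_mul_gaussSum_eq_card hχ (isPrimitive_stdAddChar q)
  have h2 : gaussSum χ⁻¹ (stdAddChar : AddChar (ZMod q) ℂ)⁻¹
      = (starRingEnd ℂ) (gaussSum χ stdAddChar) := by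
    simp only [gaussSum, map_sum, map_mul]
    refine sum_congr rfl fun x _ => ?_
    rw [AddChar.inv_apply, AddChar.map_neg_eq_conj, ← MulChar.star_apply', ← starRingEnd_apply]
  rw [h2, Complex.mul_conj, ZMod.card, Complex.normSq_eq_norm_sq] at h
  exact_mod_cast h

lemma isPrimitive_of_prime {q : ℕ} [Fact q.Prime] {χ : DirichletCharacter ℂ q} (hχ : χ ≠ 1) :
    χ.IsPrimitive := by
  rcases (Nat.dvd_prime (Fact.out : q.Prime)).1 (conductor_dvd_level χ) with h | h
  · exact absurd ((eq_one_iff_conductor_eq_one).2 h) hχ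
  · exact h

lemma norm_LFunction_zero_le {q : ℕ} [Fact q.Prime] {χ : DirichletCharacter ℂ q} (hχ : χ ≠ 1) :
    ‖DirichletCharacter.LFunction χ 0‖ ≤ √q * ‖DirichletCharacter.LFunction χ⁻¹ 1‖ := by
  have hq : q.Prime := Fact.out
  have hq0 : (0 : ℝ) < q := by exact_mod_cast hq.pos
  rcases χ.even_or_odd with h | h
  · rw [DirichletCharacter.LFunction, ZMod.LFunction_apply_zero_of_even h.to_fun, χ.map_zero' hq.ne_one]
    simp only [neg_zero, zero_div, norm_zero]
    positivity
  have h' : χ⁻¹.Odd := by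
    rw [DirichletCharacter.Odd] at h ⊢
    rw [MulChar.inv_apply', inv_neg, inv_one, h]
  have e1 : DirichletCharacter.LFunction χ 0 = DirichletCharacter.completedLFunction χ 0 := by
    rw [LFunction_eq_completed_div_gammaFactor χ 0 (Or.inr hq.ne_one), h.gammaFactor_def, zero_add,
      Gammaℝ_one, div_one]
  have e2 : DirichletCharacter.LFunction χ⁻¹ 1 =
      DirichletCharacter.completedLFunction χ⁻¹ 1 * π := by
    rw [LFunction_eq_completed_div_gammaFactor _ 1 (Or.inr hq.ne_one), h'.gammaFactor_def,
      Gammaℝ_def]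
    norm_num [Complex.cpow_neg_one]
  have e3 := (isPrimitive_of_prime hχ).completedLFunction_one_sub 1
  rw [sub_self] at e3
  have hroot : ‖rootNumber χ‖ = 1 := by
    have hg : ‖gaussSum χ (stdAddChar : AddChar (ZMod q) ℂ)‖ = √q := by
      rw [← norm_gaussSum_sq hχ, Real.sqrt_sq (norm_nonneg _)]
    rw [rootNumber, norm_div, norm_div, hg, norm_pow, Complex.norm_I, one_pow, div_one,
      Complex.norm_natCast_cpow_of_pos hq.pos]
    norm_num [← Real.sqrt_eq_rpow]
    exact hq.ne_zero
  rw [e1, e3, e2, norm_mul, norm_mul, hroot, Complex.norm_natCast_cpow_of_pos hq.pos, norm_mul,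
    norm_real, Real.norm_eq_abs, abs_of_pos Real.pi_pos]
  norm_num [← Real.sqrt_eq_rpow]
  gcongr
  nlinarith [Real.pi_gt_three, norm_nonneg (DirichletCharacter.completedLFunction χ⁻¹ 1)]

lemma conj_char_apply {q : ℕ} [Fact q.Prime] (χ : DirichletCharacter ℂ q) (x : ZMod q) :
    (starRingEnd ℂ) (χ x) = χ x⁻¹ := by
  rw [starRingEnd_apply, MulChar.star_apply', MulChar.inv_apply']

lemma sum_conj_char_mul_char {q : ℕ} [Fact q.Prime] (χ χ' : DirichletCharacter ℂ q) :
    ∑ k, (starRingEnd ℂ) (χ k) * χ' k = if χ = χ' then (q.totient : ℂ) else 0 := by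
  have h : ∀ k, (starRingEnd ℂ) (χ k) * χ' k = (χ⁻¹ * χ') k := fun k => by
    rw [starRingEnd_apply, MulChar.star_apply', MulChar.mul_apply]
  simp only [h]
  split_ifs with hχ
  · subst hχ
    rw [inv_mul_cancel, MulChar.sum_one_eq_card_units, ZMod.card_units_eq_totient]
  · exact MulChar.sum_eq_zero_of_ne_one (by rwa [Ne, inv_mul_eq_one])

lemma sum_norm_sq_char_transform {q : ℕ} [Fact q.Prime] (s : Finset (DirichletCharacter ℂ q))
    (a : DirichletCharacter ℂ q → ℂ) :
    ∑ k : ZMod q, ‖∑ χ ∈ s, (starRingEnd ℂ) (χ k) * a χ‖ ^ 2 = q.totient * ∑ χ ∈ s, ‖a χ‖ ^ 2 := by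
  rw [← Complex.ofReal_inj]
  push_cast
  simp only [← Complex.mul_conj', map_sum, map_mul, Complex.conj_conj, sum_mul_sum]
  rw [sum_comm]
  simp only [sum_comm (s := (univ : Finset (ZMod q)))]
  have h : ∀ χ ∈ s, ∀ χ' ∈ s, ∑ k : ZMod q, (starRingEnd ℂ) (χ k) * a χ *
      (χ' k * (starRingEnd ℂ) (a χ'))
      = if χ = χ' then (q.totient : ℂ) * (a χ * (starRingEnd ℂ) (a χ')) else 0 := by
    intro χ _ χ' _
    have := sum_conj_char_mul_char χ χ'
    calc _ = (∑ k, (starRingEnd ℂ) (χ k) * χ' k) * (a χ * (starRingEnd ℂ) (a χ')) := by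
          rw [sum_mul]; exact sum_congr rfl fun _ _ => by ring
      _ = _ := by rw [this]; split_ifs <;> simp
  rw [mul_sum]
  refine sum_congr rfl fun χ hχ => ?_
  rw [sum_congr rfl (h χ hχ), sum_ite_eq, if_pos hχ]

lemma sum_norm_sq_char_sum_le {q : ℕ} [Fact q.Prime] (e : ZMod q → ℂ) :
    ∑ χ : DirichletCharacter ℂ q, ‖∑ x, e x * χ x‖ ^ 2 ≤ q.totient * ∑ x, ‖e x‖ ^ 2 := by
  have key : ∑ χ : DirichletCharacter ℂ q, ‖∑ x, e x * χ x‖ ^ 2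
      = q.totient * ∑ x ∈ univ.erase 0, ‖e x‖ ^ 2 := by
    rw [← Complex.ofReal_inj]
    push_cast
    simp only [← Complex.mul_conj', map_sum, map_mul, conj_char_apply, sum_mul_sum]
    rw [sum_comm]
    simp only [sum_comm (s := (univ : Finset (DirichletCharacter ℂ q)))]
    have h : ∀ x y : ZMod q, ∑ χ : DirichletCharacter ℂ q, e x * χ x *
        ((starRingEnd ℂ) (e y) * χ y⁻¹)
        = if y = x then (if y = 0 then 0 else
          (q.totient : ℂ) * (e x * (starRingEnd ℂ) (e y))) else 0 := by
      intro x y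
      rcases eq_or_ne y 0 with rfl | hy
      · simp [MulChar.map_nonunit]
      have := sum_char_inv_mul_char_eq ℂ (isUnit_iff_ne_zero.2 hy) x
      calc _ = (∑ χ : DirichletCharacter ℂ q, χ y⁻¹ * χ x) * (e x * (starRingEnd ℂ) (e y)) := by
            rw [sum_mul]; exact sum_congr rfl fun _ _ => by ring
        _ = _ := by rw [this]; simp [hy]
    simp only [h, sum_ite_eq', mem_univ, if_true]
    rw [mul_sum, ← sum_erase (a := 0) _ (by simp)]
    exact sum_congr rfl fun x hx => by simp [(mem_erase.1 hx).1]
  rw [key]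
  gcongr
  exact erase_subset _ _

end CharacterEstimates

section DivisorBound

open Finset

lemma exists_card_divisors_le {δ : ℝ} (hδ : 0 < δ) :
    ∃ C : ℝ, 0 < C ∧ ∀ n : ℕ, n ≠ 0 → (#n.divisors : ℝ) ≤ C * (n : ℝ) ^ δ := by
  set D : ℝ := max 1 (1 / (δ * Real.log 2)) with hD
  have hlog : 0 < Real.log 2 := Real.log_pos one_lt_two
  have hD1 : 1 ≤ D := le_max_left _ _
  obtain ⟨P, hP⟩ := exists_nat_ge ((2 : ℝ) ^ (1 / δ))
  refine ⟨D ^ P, by positivity, fun n hn => ?_⟩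
  have hlocal : ∀ p ∈ n.primeFactors, ((n.factorization p + 1 : ℕ) : ℝ) ≤
      (if p < P then D else 1) * ((p : ℝ) ^ n.factorization p) ^ δ := by
    intro p hp
    have hp2 : (2 : ℝ) ≤ p := by exact_mod_cast (Nat.prime_of_mem_primeFactors hp).two_le
    set a := n.factorization p
    rw [← Real.rpow_natCast, ← Real.rpow_mul (by positivity), mul_comm (a : ℝ) δ]
    push_cast
    split_ifs with h
    · have h1 : (2 : ℝ) ^ (δ * a) ≤ (p : ℝ) ^ (δ * a) := by gcongr
      have h2 : 1 + δ * a * Real.log 2 ≤ (2 : ℝ) ^ (δ * a) := by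
        rw [Real.rpow_def_of_pos two_pos]
        linarith [Real.add_one_le_exp (Real.log 2 * (δ * a))]
      have h3 : 1 ≤ D * (δ * Real.log 2) := by
        calc 1 = 1 / (δ * Real.log 2) * (δ * Real.log 2) := by field_simp
          _ ≤ _ := by gcongr; exact le_max_right _ _
      have ha : (0 : ℝ) ≤ a := a.cast_nonneg
      calc (a : ℝ) + 1 ≤ D * (1 + δ * a * Real.log 2) := by nlinarith
        _ ≤ _ := by gcongr; exact h2.trans h1
    · have h1 : (2 : ℝ) ≤ (p : ℝ) ^ δ := by
        have : (2 : ℝ) ^ (1 / δ) ≤ p := hP.trans (by exact_mod_cast not_lt.1 h)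
        calc (2 : ℝ) = ((2 : ℝ) ^ (1 / δ)) ^ δ := by
              rw [← Real.rpow_mul two_pos.le, one_div_mul_cancel hδ.ne', Real.rpow_one]
          _ ≤ _ := by gcongr
      rw [one_mul, Real.rpow_mul (by positivity), Real.rpow_natCast]
      calc (a : ℝ) + 1 ≤ 2 ^ a := by exact_mod_cast Nat.lt_two_pow_self
        _ ≤ _ := by gcongr
  have hprod : (n : ℝ) ^ δ = ∏ p ∈ n.primeFactors, ((p : ℝ) ^ n.factorization p) ^ δ := by
    rw [Real.finsetProd_rpow _ _ fun p _ => by positivity]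
    conv_lhs => rw [← Nat.prod_factorization_pow_eq_self hn]
    rw [Finsupp.prod, Nat.support_factorization]
    push_cast
    rfl
  rw [Nat.card_divisors hn, hprod]
  push_cast only [Nat.cast_prod]
  refine (prod_le_prod (fun _ _ => by positivity) hlocal).trans ?_
  rw [prod_mul_distrib]
  gcongr
  rw [prod_ite, prod_const, prod_const_one, mul_one]
  refine pow_le_pow_right₀ hD1 ?_
  calc _ ≤ #(range P) := card_le_card fun p hp => by simpa using (mem_filter.1 hp).2
    _ = P := card_range P

end DivisorBound

section Transform

open Finset

lemma sum_abs_zsaw_sub_sq_le {q m : ℕ} [NeZero q] (hm : 1 ≤ m) (hmq : m ≤ q) :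
    ∑ k : ZMod q, |zsaw q k - zsaw q (k + m)| ^ 2 ≤ 3 * m := by
  have hq : (0 : ℝ) < q := by exact_mod_cast NeZero.pos q
  have hmq' : (m : ℝ) ≤ q := by exact_mod_cast hmq
  have hm' : (1 : ℝ) ≤ m := by exact_mod_cast hm
  have hpt : ∀ k : ZMod q, |zsaw q k - zsaw q (k + m)| ^ 2 ≤
      (m / q : ℝ) ^ 2 + if k = 0 ∨ q ≤ k.val + m then 1 else 0 := by
    intro k
    split_ifs with h
    · have h1 : |zsaw q k - zsaw q (k + m)| ≤ 1 :=
        (abs_sub _ _).trans (by linarith [abs_zsaw_le k, abs_zsaw_le (k + (m : ZMod q))])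
      have := pow_le_one₀ (n := 2) (abs_nonneg _) h1
      nlinarith [sq_nonneg (m / q : ℝ)]
    · push Not at h
      obtain ⟨h0, hlt⟩ := h
      have hv : (k + m : ZMod q).val = k.val + m := by
        have : (k + m : ZMod q) = ((k.val + m : ℕ) : ZMod q) := by simp
        rw [this, ZMod.val_natCast_of_lt hlt]
      have h1 : (k + m : ZMod q) ≠ 0 := by
        intro h2
        rw [h2, ZMod.val_zero] at hv
        omega
      rw [zsaw, zsaw, if_neg h0, if_neg h1, hv, sq_abs]
      apply le_of_eq
      push_cast
      ring
  refine (sum_le_sum fun k _ => hpt k).trans ?_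
  rw [sum_add_distrib, sum_const, card_univ, ZMod.card, nsmul_eq_mul, sum_boole]
  have hcard : #{k : ZMod q | k = 0 ∨ q ≤ k.val + m} ≤ m + 1 := by
    calc _ ≤ #(insert 0 (Ico (q - m) q)) := by
          refine card_le_card_of_injOn ZMod.val ?_ (ZMod.val_injective q).injOn
          intro k hk
          have hlt := ZMod.val_lt k
          rcases (mem_filter.1 hk).2 with rfl | h
          · simp
          · exact mem_insert_of_mem (mem_Ico.2 ⟨by omega, hlt⟩)
      _ ≤ #(Ico (q - m) q) + 1 := card_insert_le _ _
      _ = m + 1 := by rw [Nat.card_Ico]; omega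
  have hcard' : (#{k : ZMod q | k = 0 ∨ q ≤ k.val + m} : ℝ) ≤ m + 1 := by exact_mod_cast hcard
  have hsq : (q : ℝ) * (m / q) ^ 2 ≤ m := by
    calc (q : ℝ) * (m / q) ^ 2 = m * (m / q) := by field_simp
      _ ≤ m * 1 := by gcongr; exact (div_le_one hq).2 hmq'
      _ = m := mul_one _
  linarith

/-- The transform `k ↦ φ(q)⁻¹ ∑_{χ ≠ χ₀} conj χ(k) L(0,χ) Φ(χ)` of a function `Φ` of `χ`. -/
noncomputable def charTransform {q : ℕ} [NeZero q] (Φ : DirichletCharacter ℂ q → ℂ)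
    (k : ZMod q) : ℂ :=
  (q.totient : ℂ)⁻¹ * ∑ χ ∈ univ.filter (fun χ : DirichletCharacter ℂ q => χ ≠ 1),
    (starRingEnd ℂ) (χ k) * (DirichletCharacter.LFunction χ 0 * Φ χ)

lemma charTransform_sum {q : ℕ} [NeZero q] {ι : Type*} (s : Finset ι) (c : ι → ℂ)
    (Φ : ι → DirichletCharacter ℂ q → ℂ) (k : ZMod q) :
    charTransform (fun χ => ∑ i ∈ s, c i * Φ i χ) k = ∑ i ∈ s, c i * charTransform (Φ i) k := by
  simp only [charTransform, mul_sum]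
  rw [sum_comm]
  exact sum_congr rfl fun i _ => sum_congr rfl fun χ _ => by ring

lemma charTransform_sub {q : ℕ} [NeZero q] (Φ Ψ : DirichletCharacter ℂ q → ℂ) (k : ZMod q) :
    charTransform (fun χ => Φ χ - Ψ χ) k = charTransform Φ k - charTransform Ψ k := by
  simp only [charTransform, mul_sub, sum_sub_distrib]

lemma charTransform_char_mul {q : ℕ} [Fact q.Prime] (d : ZMod q)
    (Φ : DirichletCharacter ℂ q → ℂ) (k : ZMod q) :
    charTransform (fun χ => χ d * Φ χ) k = charTransform Φ (k * d⁻¹) := by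
  simp only [charTransform, conj_char_apply, inv_inv, map_mul]
  congr 1
  exact sum_congr rfl fun χ _ => by ring

lemma sum_zsaw {q : ℕ} [NeZero q] : ∑ x, zsaw q x = 0 := by
  have : ∑ x, zsaw q x = -∑ x, zsaw q x := by
    rw [← sum_neg_distrib]
    exact Fintype.sum_equiv (Equiv.neg _) _ _ fun x => by rw [Equiv.neg_apply, zsaw_neg, neg_neg]
  linarith

lemma charTransform_one {q : ℕ} [Fact q.Prime] (k : ZMod q) :
    charTransform (fun _ => 1) k = zsaw q k := by
  have hq : q.Prime := Fact.out
  have hφ : (q.totient : ℂ) ≠ 0 := by exact_mod_cast (Nat.totient_pos.2 hq.pos).ne'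
  rcases eq_or_ne k 0 with rfl | hk
  · simp [charTransform, zsaw, MulChar.map_nonunit]
  have h1 : ∑ x, (1 : DirichletCharacter ℂ q) x * (zsaw q x : ℂ) = 0 := by
    have h2 : ∀ x : ZMod q, (1 : DirichletCharacter ℂ q) x * (zsaw q x : ℂ) = zsaw q x := by
      intro x
      rcases eq_or_ne x 0 with rfl | hx
      · simp [zsaw]
      · rw [MulChar.one_apply (isUnit_iff_ne_zero.2 hx), one_mul]
    simp only [h2]
    exact_mod_cast sum_zsaw
  have h3 : ∑ χ ∈ univ.filter (fun χ : DirichletCharacter ℂ q => χ ≠ 1),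
      (starRingEnd ℂ) (χ k) * (DirichletCharacter.LFunction χ 0 * 1)
      = ∑ χ : DirichletCharacter ℂ q, (starRingEnd ℂ) (χ k) * ∑ x, χ x * (zsaw q x : ℂ) := by
    rw [sum_filter]
    refine sum_congr rfl fun χ _ => ?_
    split_ifs with h
    · rw [LFunction_zero_eq_sum hq.ne_one, mul_one]
    · rw [not_not.1 h, h1, mul_zero]
  have h5 : ∑ χ : DirichletCharacter ℂ q, (starRingEnd ℂ) (χ k) * ∑ x, χ x * (zsaw q x : ℂ)
      = ∑ x, ∑ χ : DirichletCharacter ℂ q, χ k⁻¹ * (χ x * (zsaw q x : ℂ)) := by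
    simp only [mul_sum, conj_char_apply]
    exact sum_comm
  rw [charTransform, h3, h5]
  have h4 : ∀ x : ZMod q, ∑ χ : DirichletCharacter ℂ q, χ k⁻¹ * (χ x * (zsaw q x : ℂ))
      = if k = x then (q.totient : ℂ) * zsaw q x else 0 := by
    intro x
    have := DirichletCharacter.sum_char_inv_mul_char_eq ℂ (isUnit_iff_ne_zero.2 hk) x
    simp only [← mul_assoc, ← sum_mul]
    rw [this]
    split_ifs <;> simp
  simp only [h4, sum_ite_eq, mem_univ, if_true]
  field_simp

lemma charTransform_char {q : ℕ} [Fact q.Prime] (d k : ZMod q) :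
    charTransform (fun χ => χ d) k = zsaw q (k * d⁻¹) := by
  have := charTransform_char_mul d (fun _ => 1) k
  simpa [charTransform_one] using this

end Transform

section TailBound

open Finset

lemma sum_rpow_le_tsum {s : ℝ} (hs : 1 < s) (t : Finset ℕ) :
    ∑ n ∈ t, (n : ℝ) ^ (-s) ≤ ∑' n : ℕ, (n : ℝ) ^ (-s) :=
  (Real.summable_nat_rpow.2 (by linarith)).sum_le_tsum t fun n _ => by positivity

lemma norm_toLp_char_sum_le {q : ℕ} [Fact q.Prime] (e : ZMod q → ℂ) :
    ‖WithLp.toLp 2 (fun χ : DirichletCharacter ℂ q => ∑ x, e x * χ x)‖ ≤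
      √(q.totient * ∑ x, ‖e x‖ ^ 2) := by
  rw [EuclideanSpace.norm_eq]
  exact Real.sqrt_le_sqrt (sum_norm_sq_char_sum_le e)

lemma norm_toLp_char_poly_le {δ C : ℝ} (hδ : 0 < δ) (hδ1 : 14 * δ < 1) (hC : 0 ≤ C) {q N : ℕ}
    [Fact q.Prime] (hN : N + 1 ≤ q) {e : ℕ → ℝ} (he : ∀ n, |e n| ≤ C * (n : ℝ) ^ (δ - 1))
    (he0 : ∀ n ≤ N, e n = 0) :
    ‖WithLp.toLp 2 (fun χ : DirichletCharacter ℂ q => ∑ n ∈ range (q * q ^ 3), (e n : ℂ) * χ n)‖ ≤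
      √q.totient * (C * (√(∑' n : ℕ, (n : ℝ) ^ (-(1 + 2 * δ))) + ∑' n : ℕ, (n : ℝ) ^ (-(1 + δ))) *
        ((N : ℝ) + 1) ^ (7 * δ - 1 / 2)) := by
  have hq0 : 0 < q := (Fact.out : q.Prime).pos
  have hq : (0 : ℝ) < q := by exact_mod_cast hq0
  have hNq : (N : ℝ) + 1 ≤ q := by exact_mod_cast hN
  set Z := ∑' n : ℕ, (n : ℝ) ^ (-(1 + 2 * δ))
  set Z' := ∑' n : ℕ, (n : ℝ) ^ (-(1 + δ))
  have hZ : 0 ≤ Z := tsum_nonneg fun n => by positivity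
  have hZ' : 0 ≤ Z' := tsum_nonneg fun n => by positivity
  set v : ℕ → EuclideanSpace ℂ (DirichletCharacter ℂ q) := fun j =>
    WithLp.toLp 2 fun χ => ∑ x : ZMod q, (e (q * j + x.val) : ℂ) * χ x with hv
  have hsplit : WithLp.toLp 2 (fun χ : DirichletCharacter ℂ q =>
      ∑ n ∈ range (q * q ^ 3), (e n : ℂ) * χ n) = ∑ j ∈ range (q ^ 3), v j := by
    ext χ
    simp [hv, sum_range_mul_zmod]
  have hblock : ∀ j, ‖v j‖ ≤ √q.totient * √(∑ x : ZMod q, e (q * j + x.val) ^ 2) := by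
    intro j
    refine (norm_toLp_char_sum_le _).trans (le_of_eq ?_)
    rw [Real.sqrt_mul (Nat.cast_nonneg _)]
    simp
  have hsq : ∀ n, e n ^ 2 ≤ C ^ 2 * (n : ℝ) ^ (2 * δ - 2) := by
    intro n
    have h2 : ((n : ℝ) ^ (δ - 1)) ^ 2 = (n : ℝ) ^ (2 * δ - 2) := by
      rw [← Real.rpow_natCast, ← Real.rpow_mul n.cast_nonneg]
      push_cast
      ring_nf
    have := pow_le_pow_left₀ (abs_nonneg _) (he n) 2
    rwa [sq_abs, mul_pow, h2] at this
  have h0 : √(∑ x : ZMod q, e (q * 0 + x.val) ^ 2) ≤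
      C * √Z * ((N : ℝ) + 1) ^ (7 * δ - 1 / 2) := by
    have h1 : ∑ x : ZMod q, e (q * 0 + x.val) ^ 2 = ∑ n ∈ range q, e n ^ 2 := by
      have := sum_range_mul_zmod (q := q) (fun n => e n ^ 2) 1
      rw [mul_one] at this
      rw [this, sum_range_one]
    have h2 : ∀ n, e n ^ 2 ≤ C ^ 2 * ((N : ℝ) + 1) ^ (4 * δ - 1) * (n : ℝ) ^ (-(1 + 2 * δ)) := by
      intro n
      rcases le_or_gt n N with h | h
      · rw [he0 n h, zero_pow two_ne_zero]
        positivity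
      have hn : (0 : ℝ) < n := by exact_mod_cast (Nat.zero_le N).trans_lt h
      have hn' : (N : ℝ) + 1 ≤ n := by exact_mod_cast h
      calc e n ^ 2 ≤ C ^ 2 * (n : ℝ) ^ (2 * δ - 2) := hsq n
        _ = C ^ 2 * (n : ℝ) ^ (4 * δ - 1) * (n : ℝ) ^ (-(1 + 2 * δ)) := by
            rw [mul_assoc, ← Real.rpow_add hn]
            ring_nf
        _ ≤ _ := by
            gcongr ?_ * ?_ * _
            exact Real.rpow_le_rpow_of_nonpos (by positivity) hn' (by linarith)
    have h3 : ∑ n ∈ range q, e n ^ 2 ≤ (C * √Z * ((N : ℝ) + 1) ^ (2 * δ - 1 / 2)) ^ 2 := by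
      calc _ ≤ ∑ n ∈ range q, C ^ 2 * ((N : ℝ) + 1) ^ (4 * δ - 1) * (n : ℝ) ^ (-(1 + 2 * δ)) :=
            sum_le_sum fun n _ => h2 n
        _ ≤ C ^ 2 * ((N : ℝ) + 1) ^ (4 * δ - 1) * Z := by
            rw [← mul_sum]
            gcongr
            exact sum_rpow_le_tsum (by linarith) _
        _ = _ := by
            rw [mul_pow, mul_pow, Real.sq_sqrt hZ, ← Real.rpow_natCast (((N : ℝ) + 1) ^ _),
              ← Real.rpow_mul (by positivity)]
            push_cast
            ring_nf
    rw [h1]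
    refine (Real.sqrt_le_sqrt h3).trans ?_
    rw [Real.sqrt_sq (by positivity)]
    gcongr
    · linarith [(Nat.cast_nonneg N : (0 : ℝ) ≤ N)]
    · linarith
  have hj : ∀ j ∈ range (q ^ 3), j ≠ 0 → √(∑ x : ZMod q, e (q * j + x.val) ^ 2) ≤
      C * (q : ℝ) ^ (7 * δ - 1 / 2) * (j : ℝ) ^ (-(1 + δ)) := by
    intro j hj hj0
    have hj1 : (0 : ℝ) < j := by exact_mod_cast Nat.pos_of_ne_zero hj0
    have hjq : (j : ℝ) ≤ (q : ℝ) ^ (3 : ℝ) := by exact_mod_cast (mem_range.1 hj).le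
    have h1 : ∀ x : ZMod q, e (q * j + x.val) ^ 2 ≤ C ^ 2 * ((q : ℝ) * j) ^ (2 * δ - 2) := by
      intro x
      refine (hsq _).trans ?_
      gcongr ?_ * ?_
      refine Real.rpow_le_rpow_of_nonpos (by positivity) ?_ (by linarith)
      push_cast
      linarith [(Nat.cast_nonneg x.val : (0 : ℝ) ≤ x.val)]
    have h2 : ∑ x : ZMod q, e (q * j + x.val) ^ 2 ≤
        (C * ((q : ℝ) ^ (δ - 1 / 2) * (j : ℝ) ^ (δ - 1))) ^ 2 := by
      refine (sum_le_sum fun x _ => h1 x).trans (le_of_eq ?_)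
      rw [sum_const, card_univ, ZMod.card, nsmul_eq_mul, mul_pow, mul_pow,
        Real.mul_rpow hq.le hj1.le, ← Real.rpow_natCast ((q : ℝ) ^ _),
        ← Real.rpow_natCast ((j : ℝ) ^ _), ← Real.rpow_mul hq.le, ← Real.rpow_mul hj1.le]
      have : (q : ℝ) ^ ((δ - 1 / 2) * ((2 : ℕ) : ℝ)) = q * (q : ℝ) ^ (2 * δ - 2) := by
        rw [← Real.rpow_one_add' hq.le (by linarith)]
        push_cast
        ring_nf
      rw [this]
      push_cast
      ring_nf
    refine (Real.sqrt_le_sqrt h2).trans ?_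
    rw [Real.sqrt_sq (by positivity), mul_assoc]
    gcongr C * ?_
    calc (q : ℝ) ^ (δ - 1 / 2) * (j : ℝ) ^ (δ - 1)
        = (q : ℝ) ^ (δ - 1 / 2) * ((j : ℝ) ^ (2 * δ) * (j : ℝ) ^ (-(1 + δ))) := by
          rw [← Real.rpow_add hj1]
          ring_nf
      _ ≤ (q : ℝ) ^ (δ - 1 / 2) * (((q : ℝ) ^ (3 : ℝ)) ^ (2 * δ) * (j : ℝ) ^ (-(1 + δ))) := by
          gcongr
      _ = _ := by
          rw [← Real.rpow_mul hq.le, ← mul_assoc, ← Real.rpow_add hq]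
          ring_nf
  rw [hsplit]
  refine (norm_sum_le _ _).trans ((sum_le_sum fun j _ => hblock j).trans ?_)
  rw [← mul_sum]
  gcongr
  rw [← add_sum_erase _ _ (mem_range.2 (pow_pos hq0 3)), mul_add, add_mul]
  refine add_le_add h0 ?_
  calc _ ≤ ∑ j ∈ (range (q ^ 3)).erase 0, C * (q : ℝ) ^ (7 * δ - 1 / 2) * (j : ℝ) ^ (-(1 + δ)) :=
        sum_le_sum fun j hj' => hj j (mem_erase.1 hj').2 (mem_erase.1 hj').1
    _ ≤ C * (q : ℝ) ^ (7 * δ - 1 / 2) * Z' := by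
        rw [← mul_sum]
        gcongr
        exact sum_rpow_le_tsum (by linarith) _
    _ ≤ C * ((N : ℝ) + 1) ^ (7 * δ - 1 / 2) * Z' := by
        gcongr C * ?_ * _
        exact Real.rpow_le_rpow_of_nonpos (by positivity) hNq (by linarith)
    _ = _ := by ring

lemma exists_coeff_of_prod {q : ℕ} [NeZero q] {δ C : ℝ}
    (hC : ∀ n : ℕ, n ≠ 0 → (#n.divisors : ℝ) ≤ C * (n : ℝ) ^ δ) (hδ : δ < 1) (N : ℕ) :
    ∃ e : ℕ → ℝ, (∀ n, |e n| ≤ C * (n : ℝ) ^ (δ - 1)) ∧ (∀ n ≤ N, e n = 0) ∧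
      ∀ χ : DirichletCharacter ℂ q, (∑ n ∈ range (q * q), χ n / n) *
        (∑ n ∈ Ico (N + 1) (q * q), χ n / n) = ∑ n ∈ range (q * q ^ 3), (e n : ℂ) * χ n := by
  set s := range (q * q) ×ˢ Ico (N + 1) (q * q) with hs
  refine ⟨fun n => #(s.filter fun p => p.1 * p.2 = n) / n, fun n => ?_, fun n hn => ?_, fun χ => ?_⟩
  · rcases eq_or_ne n 0 with rfl | hn
    · simp [Real.zero_rpow (sub_ne_zero.2 hδ.ne)]
    have hn' : (0 : ℝ) < n := by exact_mod_cast Nat.pos_of_ne_zero hn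
    have h1 : #(s.filter fun p => p.1 * p.2 = n) ≤ #n.divisors := by
      refine card_le_card_of_injOn Prod.fst (fun p hp => ?_) fun p hp p' hp' h => ?_
      · exact Nat.mem_divisors.2 ⟨⟨p.2, (mem_filter.1 hp).2.symm⟩, hn⟩
      · have h1 := (mem_filter.1 hp).2
        have h2 := (mem_filter.1 hp').2
        have h3 : p'.1 ≠ 0 := by
          rintro h4
          rw [h4, zero_mul] at h2
          exact hn h2.symm
        rw [h, ← h2] at h1
        exact Prod.ext h (Nat.eq_of_mul_eq_mul_left (Nat.pos_of_ne_zero h3) h1)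
    rw [abs_of_nonneg (by positivity), Real.rpow_sub_one hn'.ne', ← mul_div_assoc]
    refine div_le_div_of_nonneg_right ?_ hn'.le
    exact le_trans (by exact_mod_cast h1) (hC n hn)
  · rcases eq_or_ne n 0 with rfl | hn0
    · simp
    have : s.filter (fun p => p.1 * p.2 = n) = ∅ := by
      refine filter_eq_empty_iff.2 fun p hp h => ?_
      have h1 := (mem_Ico.1 (mem_product.1 hp).2).1
      have h2 : p.2 ≤ n := Nat.le_of_dvd (Nat.pos_of_ne_zero hn0) (h ▸ dvd_mul_left _ _)
      omega
    simp [this]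
  · rw [sum_mul_sum, ← sum_product', ← hs]
    have hmaps : ∀ p ∈ s, p.1 * p.2 ∈ range (q * q ^ 3) := by
      intro p hp
      obtain ⟨h1, h2⟩ := mem_product.1 hp
      rw [mem_range] at h1 ⊢
      calc p.1 * p.2 < (q * q) * (q * q) :=
            Nat.mul_lt_mul'' h1 (mem_Ico.1 h2).2
        _ = q * q ^ 3 := by ring
    rw [← sum_fiberwise_of_maps_to hmaps]
    refine sum_congr rfl fun n _ => ?_
    have : ∀ p ∈ s.filter (fun p => p.1 * p.2 = n),
        χ (p.1 : ZMod q) / (p.1 : ℂ) * (χ (p.2 : ZMod q) / (p.2 : ℂ)) = χ n / n := by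
      intro p hp
      rw [← (mem_filter.1 hp).2, div_mul_div_comm, ← map_mul]
      push_cast
      rfl
    rw [sum_congr rfl this, sum_const, nsmul_eq_mul]
    push_cast
    ring

lemma norm_char_sum_div_le {q : ℕ} [NeZero q] (χ : DirichletCharacter ℂ q) {t : Finset ℕ}
    (ht : t ⊆ range (q * q)) :
    ‖∑ n ∈ t, χ n / n‖ ≤ √q * ∑' n : ℕ, (n : ℝ) ^ (-(5 / 4 : ℝ)) := by
  have hq : (0 : ℝ) < q := by exact_mod_cast NeZero.pos q
  have h : ∀ n ∈ t, ‖χ n / n‖ ≤ √q * (n : ℝ) ^ (-(5 / 4 : ℝ)) := by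
    intro n hn
    rcases eq_or_ne n 0 with rfl | hn0
    · simp
    have hn' : (0 : ℝ) < n := by exact_mod_cast Nat.pos_of_ne_zero hn0
    have hnq : (n : ℝ) ≤ (q : ℝ) * q := by exact_mod_cast (mem_range.1 (ht hn)).le
    have h1 : (n : ℝ) ^ (1 / 4 : ℝ) ≤ √q := by
      calc (n : ℝ) ^ (1 / 4 : ℝ) ≤ ((q : ℝ) * q) ^ (1 / 4 : ℝ) := by gcongr
        _ = √q := by
          rw [Real.mul_rpow hq.le hq.le, ← Real.rpow_add hq, Real.sqrt_eq_rpow]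
          norm_num
    calc ‖χ n / n‖ = ‖χ n‖ / n := by rw [norm_div, Complex.norm_natCast]
      _ ≤ 1 / n := by gcongr; exact χ.norm_le_one _
      _ = (n : ℝ) ^ (1 / 4 : ℝ) * (n : ℝ) ^ (-(5 / 4 : ℝ)) := by
        rw [← Real.rpow_add hn', one_div, ← Real.rpow_neg_one]
        norm_num
      _ ≤ _ := by gcongr
  refine (norm_sum_le_of_le _ h).trans ?_
  rw [← mul_sum]
  gcongr
  exact sum_rpow_le_tsum (by norm_num) _

lemma norm_LFunction_zero_mul_le {q N : ℕ} [Fact q.Prime] {χ : DirichletCharacter ℂ q}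
    (hχ : χ ≠ 1) (hN : N + 1 ≤ q) :
    ‖DirichletCharacter.LFunction χ 0 *
        (DirichletCharacter.LFunction χ 1 - ∑ n ∈ range (N + 1), χ n / n)‖ ≤
      √q * ‖(∑ n ∈ range (q * q), χ n / n) * (∑ n ∈ Ico (N + 1) (q * q), χ n / n)‖ +
        (2 * ∑' n : ℕ, (n : ℝ) ^ (-(5 / 4 : ℝ)) + 1) := by
  have hq1 : 1 ≤ q := (Fact.out : q.Prime).one_le
  have hq : (1 : ℝ) ≤ q := by exact_mod_cast hq1
  set Z := ∑' n : ℕ, (n : ℝ) ^ (-(5 / 4 : ℝ))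
  set S := ∑ n ∈ range (q * q), χ n / n with hS
  set T := ∑ n ∈ Ico (N + 1) (q * q), χ n / n
  have hST : S - ∑ n ∈ range (N + 1), χ n / n = T := by
    rw [hS, ← sum_range_add_sum_Ico _ (hN.trans (Nat.le_mul_self q)), add_sub_cancel_left]
  have hL : ‖DirichletCharacter.LFunction χ 1 - S‖ ≤ 1 / q :=
    norm_LFunction_one_sub_partial_sum_le (MulChar.sum_eq_zero_of_ne_one hχ)
      (fun x => χ.norm_le_one x) hq1
  have hLinv : ‖DirichletCharacter.LFunction χ⁻¹ 1 - (starRingEnd ℂ) S‖ ≤ 1 / q := by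
    have hS' : (starRingEnd ℂ) S = ∑ n ∈ range (q * q), χ⁻¹ n / n := by
      rw [hS, map_sum]
      refine sum_congr rfl fun n _ => ?_
      rw [map_div₀, starRingEnd_apply, MulChar.star_apply', Complex.conj_natCast]
    rw [hS']
    exact norm_LFunction_one_sub_partial_sum_le
      (MulChar.sum_eq_zero_of_ne_one (inv_ne_one.2 hχ)) (fun x => χ⁻¹.norm_le_one x) hq1
  have h1 : ‖DirichletCharacter.LFunction χ⁻¹ 1‖ ≤ ‖S‖ + 1 / q := by
    have := norm_le_norm_add_norm_sub' (DirichletCharacter.LFunction χ⁻¹ 1) ((starRingEnd ℂ) S)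
    rw [Complex.norm_conj] at this
    linarith
  have h2 : ‖DirichletCharacter.LFunction χ 1 - ∑ n ∈ range (N + 1), χ n / n‖ ≤ ‖T‖ + 1 / q := by
    calc _ = ‖T + (DirichletCharacter.LFunction χ 1 - S)‖ := by
          rw [← hST]; congr 1; ring
      _ ≤ _ := (norm_add_le _ _).trans (by gcongr)
  have hSn : ‖S‖ ≤ √q * Z := norm_char_sum_div_le χ Subset.rfl
  have hTn : ‖T‖ ≤ √q * Z := norm_char_sum_div_le χ fun n hn => mem_range.2 (mem_Ico.1 hn).2
  have hsq : √(q : ℝ) * √q = q := Real.mul_self_sqrt (by positivity)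
  have hs1 : 1 ≤ √(q : ℝ) := Real.one_le_sqrt.2 hq
  rw [norm_mul, norm_mul]
  calc _ ≤ √q * (‖S‖ + 1 / q) * (‖T‖ + 1 / q) := by
        gcongr
        exact (norm_LFunction_zero_le hχ).trans (by gcongr)
    _ = √q * (‖S‖ * ‖T‖) + √q / q * (‖S‖ + ‖T‖ + 1 / q) := by ring
    _ ≤ √q * (‖S‖ * ‖T‖) + √q / q * (√q * Z + √q * Z + √q) := by
        gcongr
        exact (div_le_one (by positivity)).2 hq |>.trans hs1
    _ = √q * (‖S‖ * ‖T‖) + (√q * √q) / q * (2 * Z + 1) := by ring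
    _ = _ := by rw [hsq, div_self (by positivity), one_mul]

lemma norm_toLp_charTransform_le {q : ℕ} [Fact q.Prime] {Φ Ψ : DirichletCharacter ℂ q → ℂ}
    {A D : ℝ} (hA : 0 ≤ A) (hD : 0 ≤ D)
    (h : ∀ χ, χ ≠ 1 → ‖DirichletCharacter.LFunction χ 0 * Φ χ‖ ≤ A * ‖Ψ χ‖ + D) :
    √q.totient * ‖WithLp.toLp 2 (charTransform Φ)‖ ≤ A * ‖WithLp.toLp 2 Ψ‖ + √q.totient * D := by
  have hφ : (0 : ℝ) < q.totient := by
    exact_mod_cast Nat.totient_pos.2 (Fact.out : q.Prime).pos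
  set s := univ.filter (fun χ : DirichletCharacter ℂ q => χ ≠ 1)
  have h1 : √q.totient * ‖WithLp.toLp 2 (charTransform Φ)‖ =
      √(∑ χ ∈ s, ‖DirichletCharacter.LFunction χ 0 * Φ χ‖ ^ 2) := by
    rw [EuclideanSpace.norm_eq, ← Real.sqrt_mul hφ.le]
    congr 1
    have := sum_norm_sq_char_transform s (fun χ => DirichletCharacter.LFunction χ 0 * Φ χ)
    simp only [charTransform, norm_mul (q.totient : ℂ)⁻¹, mul_pow]
    rw [← mul_sum, this, norm_inv, Complex.norm_natCast]
    field_simp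
  set v : EuclideanSpace ℂ (DirichletCharacter ℂ q) :=
    WithLp.toLp 2 (fun χ => ((A * ‖Ψ χ‖ : ℝ) : ℂ))
  set w : EuclideanSpace ℂ (DirichletCharacter ℂ q) := WithLp.toLp 2 (fun χ => (D : ℂ))
  have h2 : √(∑ χ ∈ s, ‖DirichletCharacter.LFunction χ 0 * Φ χ‖ ^ 2) ≤ ‖v + w‖ := by
    rw [EuclideanSpace.norm_eq]
    refine Real.sqrt_le_sqrt ?_
    refine (sum_le_sum (g := fun χ => ‖(v + w) χ‖ ^ 2) fun χ hχ => ?_).trans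
      (sum_le_sum_of_subset_of_nonneg (subset_univ s) fun _ _ _ => by positivity)
    have h3 : ‖(v + w) χ‖ = A * ‖Ψ χ‖ + D := by
      simp only [v, w, PiLp.add_apply]
      rw [← Complex.ofReal_add, Complex.norm_real, Real.norm_of_nonneg (by positivity)]
    rw [h3]
    exact pow_le_pow_left₀ (norm_nonneg _) (h χ (mem_filter.1 hχ).2) 2
  have hv : ‖v‖ = A * ‖WithLp.toLp 2 Ψ‖ := by
    rw [EuclideanSpace.norm_eq, EuclideanSpace.norm_eq]
    simp only [v, Complex.norm_real, norm_mul, norm_norm, mul_pow, ← mul_sum]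
    rw [Real.sqrt_mul (by positivity), Real.norm_of_nonneg hA, Real.sqrt_sq hA]
  have hw : ‖w‖ = √q.totient * D := by
    rw [EuclideanSpace.norm_eq]
    simp only [w, Complex.norm_real, Real.norm_of_nonneg hD, sum_const, nsmul_eq_mul]
    rw [Real.sqrt_mul (by positivity), Real.sqrt_sq hD, card_univ, ← Nat.card_eq_fintype_card,
      DirichletCharacter.card_eq_totient_of_hasEnoughRootsOfUnity]
  rw [h1, ← hv, ← hw]
  exact h2.trans (norm_add_le _ _)

lemma exists_norm_charTransform_tail_le {σ : ℝ} (hσ0 : 0 < σ) (hσ : σ < 1 / 2) :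
    ∃ K : ℝ, 0 ≤ K ∧ ∀ (q N : ℕ) [Fact q.Prime], N + 1 ≤ q →
      ‖WithLp.toLp 2 (charTransform fun χ : DirichletCharacter ℂ q =>
        DirichletCharacter.LFunction χ 1 - ∑ n ∈ range (N + 1), χ n / n)‖ ≤
      √q * (K * ((N : ℝ) + 1) ^ (-σ)) := by
  set δ : ℝ := (1 - 2 * σ) / 14 with hδ
  have hδ0 : 0 < δ := by rw [hδ]; linarith
  obtain ⟨C, hC0, hC⟩ := exists_card_divisors_le hδ0
  set Y := √(∑' n : ℕ, (n : ℝ) ^ (-(1 + 2 * δ))) + ∑' n : ℕ, (n : ℝ) ^ (-(1 + δ))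
  have hY : 0 ≤ Y := add_nonneg (Real.sqrt_nonneg _) (tsum_nonneg fun n => by positivity)
  set D := 2 * ∑' n : ℕ, (n : ℝ) ^ (-(5 / 4 : ℝ)) + 1
  have hD : 0 ≤ D := by
    have : 0 ≤ ∑' n : ℕ, (n : ℝ) ^ (-(5 / 4 : ℝ)) := tsum_nonneg fun n => by positivity
    positivity
  refine ⟨C * Y + D, by positivity, fun q N _ hN => ?_⟩
  have hφ : (0 : ℝ) < q.totient := by
    exact_mod_cast Nat.totient_pos.2 (Fact.out : q.Prime).pos
  have hq : (0 : ℝ) < q := by exact_mod_cast (Fact.out : q.Prime).pos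
  have hNq : (N : ℝ) + 1 ≤ q := by exact_mod_cast hN
  obtain ⟨e, he, he0, heS⟩ := exists_coeff_of_prod (q := q) hC (by linarith) N
  have h1 := norm_toLp_charTransform_le (Real.sqrt_nonneg (q : ℝ)) hD
    (fun χ hχ => norm_LFunction_zero_mul_le hχ hN)
  simp only [heS] at h1
  have h2 := norm_toLp_char_poly_le hδ0 (by linarith) hC0.le hN he he0
  rw [show 7 * δ - 1 / 2 = -σ by rw [hδ]; ring] at h2
  have h3 : 1 ≤ √q * ((N : ℝ) + 1) ^ (-σ) := by
    have h4 : (q : ℝ) ^ (-σ) ≤ ((N : ℝ) + 1) ^ (-σ) :=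
      Real.rpow_le_rpow_of_nonpos (by positivity) hNq (by linarith)
    calc (1 : ℝ) ≤ (q : ℝ) ^ (1 / 2 - σ) :=
          Real.one_le_rpow (by linarith [(Nat.cast_nonneg N : (0 : ℝ) ≤ N)]) (by linarith)
      _ = √q * (q : ℝ) ^ (-σ) := by rw [Real.sqrt_eq_rpow, ← Real.rpow_add hq]; ring_nf
      _ ≤ _ := by gcongr
  refine le_of_mul_le_mul_left (h1.trans ?_) (Real.sqrt_pos.2 hφ)
  calc _ ≤ √q * (√q.totient * (C * Y * ((N : ℝ) + 1) ^ (-σ))) +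
        √q.totient * (D * (√q * ((N : ℝ) + 1) ^ (-σ))) := by
        gcongr
        exact le_mul_of_one_le_right hD h3
    _ = _ := by ring

end TailBound

section Shift

open Finset

lemma norm_toLp_comp_equiv {ι : Type*} [Fintype ι] (e : ι ≃ ι) (F : ι → ℂ) :
    ‖WithLp.toLp 2 (fun i => F (e i))‖ = ‖WithLp.toLp 2 F‖ := by
  rw [EuclideanSpace.norm_eq, EuclideanSpace.norm_eq]
  exact congrArg _ (Equiv.sum_comp e fun i => ‖F i‖ ^ 2)

lemma norm_toLp_dilate_sub_le {q : ℕ} [Fact q.Prime] {d : ZMod q} (hd : d ≠ 0) (m : ZMod q)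
    (R : ZMod q → ℂ) :
    ‖WithLp.toLp 2 (fun k => R (k * d⁻¹) - R ((k + m) * d⁻¹))‖ ≤ 2 * ‖WithLp.toLp 2 R‖ := by
  have h1 := norm_toLp_comp_equiv (Equiv.mulRight₀ d⁻¹ (inv_ne_zero hd)) R
  have h2 := norm_toLp_comp_equiv
    ((Equiv.addRight m).trans (Equiv.mulRight₀ d⁻¹ (inv_ne_zero hd))) R
  calc _ ≤ _ := norm_sub_le (WithLp.toLp 2 fun k => R (k * d⁻¹))
        (WithLp.toLp 2 fun k => R ((k + m) * d⁻¹))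
    _ = 2 * ‖WithLp.toLp 2 R‖ := by
        rw [two_mul]
        exact congrArg₂ _ h1 h2

lemma norm_toLp_zsaw_sub_le {q m n : ℕ} [Fact q.Prime] (hm : 1 ≤ m) (hmq : m < q) (hn : n ∣ m) :
    ‖WithLp.toLp 2 (fun k : ZMod q => (zsaw q (k * (n : ZMod q)⁻¹) : ℂ) -
      zsaw q ((k + m) * (n : ZMod q)⁻¹))‖ ≤ √(3 * (m / n)) := by
  obtain ⟨l, rfl⟩ := hn
  have hn0 : 0 < n := Nat.pos_of_mul_pos_right hm
  have hl0 : 0 < l := Nat.pos_of_mul_pos_left hm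
  have hlt : n < q := (Nat.le_mul_of_pos_right n hl0).trans_lt hmq
  have hnz : (n : ZMod q) ≠ 0 := by
    rw [Ne, ZMod.natCast_eq_zero_iff]
    exact Nat.not_dvd_of_pos_of_lt hn0 hlt
  have hn' : (n : ℝ) ≠ 0 := by exact_mod_cast hn0.ne'
  have h := norm_toLp_comp_equiv (Equiv.mulRight₀ (n : ZMod q)⁻¹ (inv_ne_zero hnz))
    (fun k => (zsaw q k : ℂ) - zsaw q (k + l))
  have h2 : ∀ k : ZMod q, (k + (n * l : ℕ)) * (n : ZMod q)⁻¹ = k * (n : ZMod q)⁻¹ + l := by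
    intro k
    push_cast
    field_simp
  simp only [h2]
  refine (le_of_eq h).trans ?_
  rw [EuclideanSpace.norm_eq]
  refine Real.sqrt_le_sqrt ?_
  have h3 := sum_abs_zsaw_sub_sq_le (q := q) hl0 ((Nat.le_mul_of_pos_left l hn0).trans hmq.le)
  push_cast
  rw [mul_div_cancel_left₀ _ hn']
  convert h3 using 3 with k
  rw [← Complex.ofReal_sub, Complex.norm_real, Real.norm_eq_abs]

lemma exists_norm_shift_sub_le {σ : ℝ} (hσ0 : 0 < σ) (hσ : σ < 1 / 2) :
    ∃ K : ℝ, 0 ≤ K ∧ ∀ (q : ℕ) [Fact q.Prime] (B : ℝ) (m : ℕ), 2 ≤ B → 1 ≤ m → m < q →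
      (∀ n : ℕ, 1 ≤ n → (n : ℝ) ≤ B → n ∣ m) → ∀ d : ℕ, 1 ≤ d →
      ‖WithLp.toLp 2 (fun k : ZMod q =>
        charTransform (fun χ : DirichletCharacter ℂ q => χ d * DirichletCharacter.LFunction χ 1) k -
        charTransform (fun χ : DirichletCharacter ℂ q =>
          χ d * DirichletCharacter.LFunction χ 1) (k + m))‖ ≤
      √q * (K * ((d : ℝ) ^ σ * B ^ (-σ) + √(m / q))) := by
  obtain ⟨K, hK0, hK⟩ := exists_norm_charTransform_tail_le hσ0 hσ
  set Z := ∑' n : ℕ, (n : ℝ) ^ (-(3 / 2 : ℝ))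
  have hZ : 0 ≤ Z := tsum_nonneg fun n => by positivity
  refine ⟨2 * K + √3 * Z, by positivity, fun q _ B m hB hm hmq hdvd d hd => ?_⟩
  have hq : (0 : ℝ) < q := by exact_mod_cast (Fact.out : q.Prime).pos
  have hd' : (1 : ℝ) ≤ d := by exact_mod_cast hd
  have hB0 : (0 : ℝ) < B := by linarith
  rcases eq_or_ne (d : ZMod q) 0 with hdz | hdz
  · simp only [charTransform_char_mul, hdz, inv_zero, mul_zero, sub_self]
    refine (le_of_eq ?_).trans (b := 0) (by positivity)
    exact norm_zero
  set N := ⌊B / d⌋₊ with hN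
  have hNB : (N : ℝ) ≤ B / d := Nat.floor_le (by positivity)
  have hNm : N ≤ m := by
    rcases Nat.eq_zero_or_pos N with h | h
    · omega
    · exact Nat.le_of_dvd hm (hdvd N h (hNB.trans (div_le_self hB0.le hd')))
  set R := charTransform fun χ : DirichletCharacter ℂ q =>
    DirichletCharacter.LFunction χ 1 - ∑ n ∈ range (N + 1), χ n / n
  have hdecomp : ∀ k, charTransform (fun χ : DirichletCharacter ℂ q =>
      χ d * DirichletCharacter.LFunction χ 1) k =
      R (k * (d : ZMod q)⁻¹) +
        ∑ a ∈ range (N + 1), (a : ℂ)⁻¹ * zsaw q (k * ((a * d : ℕ) : ZMod q)⁻¹) := by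
    intro k
    have h1 : (fun χ : DirichletCharacter ℂ q => χ d * ∑ n ∈ range (N + 1), χ n / n) =
        fun χ => ∑ a ∈ range (N + 1), (a : ℂ)⁻¹ * χ ((a * d : ℕ) : ZMod q) := by
      funext χ
      rw [mul_sum]
      refine sum_congr rfl fun a _ => ?_
      rw [Nat.cast_mul, map_mul]
      ring
    have h2 := charTransform_sum (range (N + 1)) (fun a => (a : ℂ)⁻¹)
      (fun a (χ : DirichletCharacter ℂ q) => χ ((a * d : ℕ) : ZMod q)) k
    simp only [charTransform_char] at h2
    have h3 : R (k * (d : ZMod q)⁻¹) = _ := (charTransform_char_mul _ _ k).symm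
    rw [← h2, ← h1, h3]
    simp only [mul_sub]
    rw [charTransform_sub, sub_add_cancel]
  set v : ℕ → EuclideanSpace ℂ (ZMod q) := fun a => WithLp.toLp 2 fun k =>
    (zsaw q (k * ((a * d : ℕ) : ZMod q)⁻¹) : ℂ) - zsaw q ((k + m) * ((a * d : ℕ) : ZMod q)⁻¹)
    with hv
  have hsplit : WithLp.toLp 2 (fun k : ZMod q =>
        charTransform (fun χ : DirichletCharacter ℂ q => χ d * DirichletCharacter.LFunction χ 1) k -
        charTransform (fun χ : DirichletCharacter ℂ q =>
          χ d * DirichletCharacter.LFunction χ 1) (k + m)) =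
      WithLp.toLp 2 (fun k => R (k * (d : ZMod q)⁻¹) - R ((k + m) * (d : ZMod q)⁻¹)) +
        ∑ a ∈ range (N + 1), (a : ℂ)⁻¹ • v a := by
    ext k
    simp only [hdecomp, PiLp.add_apply, WithLp.ofLp_sum, Finset.sum_apply, PiLp.smul_apply, hv, smul_eq_mul,
      mul_sub, sum_sub_distrib]
    ring
  have hterm : ∀ a ∈ range (N + 1), ‖(a : ℂ)⁻¹ • v a‖ ≤
      √(3 * m) * (a : ℝ) ^ (-(3 / 2 : ℝ)) := by
    intro a ha
    rcases Nat.eq_zero_or_pos a with rfl | ha0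
    · simp
    have ha' : (0 : ℝ) < a := by exact_mod_cast ha0
    have had : ((a * d : ℕ) : ℝ) ≤ B := by
      have h1 : (a : ℝ) ≤ N := by exact_mod_cast Nat.lt_succ_iff.1 (mem_range.1 ha)
      push_cast
      exact (le_div_iff₀ (by positivity)).1 (h1.trans hNB)
    have h1 : ‖v a‖ ≤ √(3 * (m / (a * d : ℕ))) :=
      norm_toLp_zsaw_sub_le hm hmq (hdvd _ (Nat.mul_pos ha0 hd) had)
    have h2 : √(3 * (m / (a * d : ℕ))) ≤ √(3 * m) * (a : ℝ) ^ (-(1 / 2 : ℝ)) := by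
      rw [Real.rpow_neg ha'.le, ← Real.sqrt_eq_rpow, ← div_eq_mul_inv, ← Real.sqrt_div (by positivity),
        mul_div_assoc]
      refine Real.sqrt_le_sqrt ?_
      gcongr
      exact Nat.le_mul_of_pos_right a hd
    rw [norm_smul, norm_inv, Complex.norm_natCast]
    calc (a : ℝ)⁻¹ * ‖v a‖ ≤ (a : ℝ)⁻¹ * (√(3 * m) * (a : ℝ) ^ (-(1 / 2 : ℝ))) := by
          gcongr
          exact h1.trans h2
      _ = √(3 * m) * ((a : ℝ) ^ (-1 : ℝ) * (a : ℝ) ^ (-(1 / 2 : ℝ))) := by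
          rw [Real.rpow_neg_one]; ring
      _ = _ := by
          rw [← Real.rpow_add ha']
          norm_num
  have hN1 : ((N : ℝ) + 1) ^ (-σ) ≤ (d : ℝ) ^ σ * B ^ (-σ) := by
    calc ((N : ℝ) + 1) ^ (-σ) ≤ (B / d) ^ (-σ) :=
          Real.rpow_le_rpow_of_nonpos (by positivity) (Nat.lt_floor_add_one _).le (by linarith)
      _ = _ := by
          rw [Real.div_rpow hB0.le (by positivity), Real.rpow_neg (Nat.cast_nonneg d), div_inv_eq_mul,
            mul_comm]
  have hsqrt : √(3 * m) = √q * (√3 * √(m / q : ℝ)) := by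
    rw [← Real.sqrt_mul (by norm_num), ← Real.sqrt_mul hq.le]
    congr 1
    field_simp
  rw [hsplit]
  calc _ ≤ 2 * ‖WithLp.toLp 2 R‖ + ∑ a ∈ range (N + 1), √(3 * m) * (a : ℝ) ^ (-(3 / 2 : ℝ)) :=
        (norm_add_le _ _).trans (add_le_add (norm_toLp_dilate_sub_le hdz _ _)
          (norm_sum_le_of_le _ hterm))
    _ ≤ 2 * (√q * (K * ((d : ℝ) ^ σ * B ^ (-σ)))) + √(3 * m) * Z := by
        rw [← mul_sum]
        gcongr
        · exact (hK q N (by omega)).trans (by gcongr)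
        · exact sum_rpow_le_tsum (by norm_num) _
    _ = √q * (2 * K * ((d : ℝ) ^ σ * B ^ (-σ)) + √3 * Z * √(m / q)) := by
        rw [hsqrt]; ring
    _ ≤ _ := by
        gcongr
        have h1 : 0 ≤ (d : ℝ) ^ σ * B ^ (-σ) := by positivity
        have h2 : 0 ≤ √(m / q : ℝ) := Real.sqrt_nonneg _
        nlinarith [mul_nonneg (mul_nonneg (Real.sqrt_nonneg 3) hZ) h1, mul_nonneg hK0 h2]

end Shift

section EulerProduct

open Finset Filter Topology

/-- The local factor at `p` of the Euler product `A_{q,χ}`. -/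
noncomputable def eulerFactor {q : ℕ} (χ : DirichletCharacter ℂ q) (p : Nat.Primes) : ℂ :=
  if (p : ℕ) ∣ q then 1 else
    1 - (1 - χ ((p : ℕ) : ZMod q)) ^ 2 / (((p : ℕ) : ℂ) - 1) ^ 2

lemma div_sub_one_sq_le {p : ℝ} (hp : 2 ≤ p) : 1 / (p - 1) ^ 2 ≤ 4 * p ^ (-2 : ℝ) := by
  rw [Real.rpow_neg (by linarith), ← div_eq_mul_inv, div_le_div_iff₀ (by nlinarith) (by positivity)]
  norm_cast
  nlinarith

lemma tendsto_prod_eulerFactor {q : ℕ} (χ : DirichletCharacter ℂ q) :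
    Tendsto (fun S : Finset Nat.Primes => ∏ p ∈ S, eulerFactor χ p) atTop (𝓝 (Aq q χ)) := by
  have hs : Summable fun p : Nat.Primes => ‖eulerFactor χ p - 1‖ := by
    refine Summable.of_nonneg_of_le (fun p => norm_nonneg _) (fun p => ?_)
      ((Nat.Primes.summable_rpow (r := -2)).2 (by norm_num) |>.mul_left 16)
    have hp : (2 : ℝ) ≤ (p : ℕ) := by exact_mod_cast p.2.two_le
    rw [eulerFactor]
    split_ifs
    · rw [sub_self, norm_zero]
      positivity
    · have h1 : ‖1 - χ ((p : ℕ) : ZMod q)‖ ≤ 2 :=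
        (norm_sub_le _ _).trans (by rw [norm_one]; linarith [χ.norm_le_one ((p : ℕ) : ZMod q)])
      have h2 : ‖((p : ℕ) : ℂ) - 1‖ = ((p : ℕ) : ℝ) - 1 := by
        rw [show ((p : ℕ) : ℂ) - 1 = ((((p : ℕ) : ℝ) - 1 : ℝ) : ℂ) by push_cast; rfl,
          Complex.norm_real, Real.norm_of_nonneg (by linarith)]
      rw [sub_sub_cancel_left, norm_neg, norm_div, norm_pow, norm_pow, h2]
      calc _ ≤ 2 ^ 2 / (((p : ℕ) : ℝ) - 1) ^ 2 := by gcongr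
        _ = 4 * (1 / (((p : ℕ) : ℝ) - 1) ^ 2) := by ring
        _ ≤ 4 * (4 * ((p : ℕ) : ℝ) ^ (-2 : ℝ)) := by gcongr; exact div_sub_one_sq_le hp
        _ = _ := by ring
  have h := (multipliable_one_add_of_summable hs).hasProd
  simp only [add_sub_cancel] at h
  exact h

lemma eulerFactor_eq {q : ℕ} {p : Nat.Primes} (hp : ¬ (p : ℕ) ∣ q) (χ : DirichletCharacter ℂ q) :
    eulerFactor χ p = ((1 - 1 / (((p : ℕ) : ℝ) - 1) ^ 2 : ℝ) : ℂ) +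
      ((2 / (((p : ℕ) : ℝ) - 1) ^ 2 : ℝ) : ℂ) * χ ((p : ℕ) : ZMod q) +
      ((-1 / (((p : ℕ) : ℝ) - 1) ^ 2 : ℝ) : ℂ) * χ (((p : ℕ) ^ 2 : ℕ) : ZMod q) := by
  rw [eulerFactor, if_neg hp]
  push_cast
  rw [map_pow]
  ring

lemma eulerFactor_weight_le {σ p : ℝ} (hσ : 0 ≤ σ) (hp : 2 ≤ p) :
    |1 - 1 / (p - 1) ^ 2| + |2 / (p - 1) ^ 2| * p ^ σ + |-1 / (p - 1) ^ 2| * (p ^ 2) ^ σ ≤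
      1 + 12 * p ^ (2 * σ - 2) := by
  have hp0 : 0 < p := by linarith
  have h1 : 1 / (p - 1) ^ 2 ≤ 1 := (div_le_one (by nlinarith)).2 (by nlinarith)
  have h0 : 0 ≤ 1 / (p - 1) ^ 2 := by positivity
  have h2 : (p ^ 2) ^ σ = p ^ (2 * σ) := by
    rw [Real.rpow_mul hp0.le]
    norm_cast
  have h3 : p ^ σ ≤ p ^ (2 * σ) := Real.rpow_le_rpow_of_exponent_le (by linarith) (by linarith)
  have h4 : p ^ (2 * σ - 2) = p ^ (-2 : ℝ) * p ^ (2 * σ) := by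
    rw [← Real.rpow_add hp0]
    ring_nf
  rw [abs_of_nonneg (by linarith), abs_of_nonneg (by positivity), neg_div, abs_neg, abs_of_nonneg h0,
    h2, h4]
  calc _ ≤ 1 + 2 / (p - 1) ^ 2 * p ^ (2 * σ) + 1 / (p - 1) ^ 2 * p ^ (2 * σ) := by
        gcongr
        linarith
    _ = 1 + 3 * (1 / (p - 1) ^ 2) * p ^ (2 * σ) := by ring
    _ ≤ 1 + 3 * (4 * p ^ (-2 : ℝ)) * p ^ (2 * σ) := by
        gcongr
        exact div_sub_one_sq_le hp
    _ = _ := by ring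

lemma exists_prod_eulerFactor_eq_sum {σ : ℝ} (hσ : 0 ≤ σ) (q : ℕ) (S : Finset Nat.Primes) :
    ∃ (r : ℕ) (c : Fin r → ℂ) (d : Fin r → ℕ), (∀ i, 1 ≤ d i) ∧
      (∀ χ : DirichletCharacter ℂ q, ∏ p ∈ S, eulerFactor χ p = ∑ i, c i * χ (d i)) ∧
      ∑ i, ‖c i‖ * (d i : ℝ) ^ σ ≤ ∏ p ∈ S, (1 + 12 * ((p : ℕ) : ℝ) ^ (2 * σ - 2)) := by
  induction S using Finset.induction_on with
  | empty => exact ⟨1, fun _ => 1, fun _ => 1, fun _ => le_rfl, fun χ => by simp, by simp⟩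
  | insert p S hpS ih =>
    obtain ⟨r, c, d, hd, hprod, hsum⟩ := ih
    have hp : (2 : ℝ) ≤ (p : ℕ) := by exact_mod_cast p.2.two_le
    have hw : 0 ≤ ∏ p ∈ S, (1 + 12 * ((p : ℕ) : ℝ) ^ (2 * σ - 2)) :=
      prod_nonneg fun p _ => by positivity
    by_cases hpq : (p : ℕ) ∣ q
    · refine ⟨r, c, d, hd, fun χ => ?_, ?_⟩
      · rw [prod_insert hpS, eulerFactor, if_pos hpq, one_mul, hprod]
      · rw [prod_insert hpS]
        refine hsum.trans (le_mul_of_one_le_left hw ?_)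
        have : 0 ≤ ((p : ℕ) : ℝ) ^ (2 * σ - 2) := by positivity
        linarith
    set α : Fin 3 → ℝ := ![1 - 1 / (((p : ℕ) : ℝ) - 1) ^ 2, 2 / (((p : ℕ) : ℝ) - 1) ^ 2,
      -1 / (((p : ℕ) : ℝ) - 1) ^ 2] with hα
    refine ⟨r * 3, fun i => c (finProdFinEquiv.symm i).1 * α (finProdFinEquiv.symm i).2,
      fun i => d (finProdFinEquiv.symm i).1 * (p : ℕ) ^ ((finProdFinEquiv.symm i).2 : ℕ),
      fun i => Nat.mul_pos (hd _) (pow_pos p.2.pos _), fun χ => ?_, ?_⟩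
    · rw [Equiv.sum_comp finProdFinEquiv.symm
        (fun x : Fin r × Fin 3 =>
          c x.1 * (α x.2 : ℂ) * χ ((d x.1 * (p : ℕ) ^ (x.2 : ℕ) : ℕ) : ZMod q)),
        Fintype.sum_prod_type, prod_insert hpS, hprod, mul_comm, sum_mul]
      refine sum_congr rfl fun i _ => ?_
      rw [Fin.sum_univ_three, eulerFactor_eq hpq]
      simp [hα]
      ring
    · rw [Equiv.sum_comp finProdFinEquiv.symm
        (fun x : Fin r × Fin 3 => ‖c x.1 * (α x.2 : ℂ)‖ *
          ((d x.1 * (p : ℕ) ^ (x.2 : ℕ) : ℕ) : ℝ) ^ σ),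
        Fintype.sum_prod_type, prod_insert hpS, mul_comm]
      refine le_trans ?_ (mul_le_mul hsum (eulerFactor_weight_le hσ hp) (by positivity) hw)
      rw [sum_mul]
      refine le_of_eq (sum_congr rfl fun i _ => ?_)
      rw [Fin.sum_univ_three]
      simp only [norm_mul, Complex.norm_real, Real.norm_eq_abs, Nat.cast_mul, Nat.cast_pow,
        Real.mul_rpow (Nat.cast_nonneg (d i)) (pow_nonneg (Nat.cast_nonneg (p : ℕ)) _)]
      simp only [hα, Fin.isValue, Matrix.cons_val, Fin.val_zero, Fin.val_one, Fin.val_two, pow_zero,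
        pow_one, Real.one_rpow]
      ring

lemma prod_one_add_le_exp {σ : ℝ} (hσ : σ < 1 / 2) (S : Finset Nat.Primes) :
    ∏ p ∈ S, (1 + 12 * ((p : ℕ) : ℝ) ^ (2 * σ - 2)) ≤
      Real.exp (∑' p : Nat.Primes, 12 * ((p : ℕ) : ℝ) ^ (2 * σ - 2)) := by
  calc _ ≤ ∏ p ∈ S, Real.exp (12 * ((p : ℕ) : ℝ) ^ (2 * σ - 2)) :=
        prod_le_prod (fun p _ => by positivity) fun p _ => by
          rw [add_comm]; exact Real.add_one_le_exp _
    _ = Real.exp (∑ p ∈ S, 12 * ((p : ℕ) : ℝ) ^ (2 * σ - 2)) := (Real.exp_sum _ _).symm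
    _ ≤ _ := by
        gcongr
        exact ((Nat.Primes.summable_rpow.2 (by linarith)).mul_left 12).sum_le_tsum S
          fun p _ => by positivity

end EulerProduct

section Conclusion

open Finset Filter Topology

lemma exists_norm_shift_sub_prod_le {σ : ℝ} (hσ0 : 0 < σ) (hσ : σ < 1 / 2) :
    ∃ K : ℝ, 0 ≤ K ∧ ∀ (q : ℕ) [Fact q.Prime] (B : ℝ) (m : ℕ), 2 ≤ B → 1 ≤ m → m < q →
      (∀ n : ℕ, 1 ≤ n → (n : ℝ) ≤ B → n ∣ m) → ∀ S : Finset Nat.Primes,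
      ‖WithLp.toLp 2 (fun k : ZMod q =>
        charTransform (fun χ : DirichletCharacter ℂ q =>
          DirichletCharacter.LFunction χ 1 * ∏ p ∈ S, eulerFactor χ p) k -
        charTransform (fun χ : DirichletCharacter ℂ q =>
          DirichletCharacter.LFunction χ 1 * ∏ p ∈ S, eulerFactor χ p) (k + m))‖ ≤
      √q * (K * (B ^ (-σ) + √(m / q))) := by
  obtain ⟨K, hK0, hK⟩ := exists_norm_shift_sub_le hσ0 hσ
  set W := Real.exp (∑' p : Nat.Primes, 12 * ((p : ℕ) : ℝ) ^ (2 * σ - 2))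
  refine ⟨K * W, by positivity, fun q _ B m hB hm hmq hdvd S => ?_⟩
  have hB0 : (0 : ℝ) < B := by linarith
  obtain ⟨r, c, d, hd, hprod, hsum⟩ := exists_prod_eulerFactor_eq_sum hσ0.le q S
  set v : Fin r → EuclideanSpace ℂ (ZMod q) := fun i => WithLp.toLp 2 fun k =>
    charTransform (fun χ : DirichletCharacter ℂ q => χ (d i) * DirichletCharacter.LFunction χ 1) k -
    charTransform (fun χ : DirichletCharacter ℂ q =>
      χ (d i) * DirichletCharacter.LFunction χ 1) (k + m) with hv
  have hdecomp : ∀ k, charTransform (fun χ : DirichletCharacter ℂ q =>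
      DirichletCharacter.LFunction χ 1 * ∏ p ∈ S, eulerFactor χ p) k =
      ∑ i, c i * charTransform (fun χ : DirichletCharacter ℂ q =>
        χ (d i) * DirichletCharacter.LFunction χ 1) k := by
    intro k
    rw [← charTransform_sum univ c (fun i (χ : DirichletCharacter ℂ q) =>
      χ (d i) * DirichletCharacter.LFunction χ 1) k]
    congr 1
    funext χ
    rw [hprod, mul_sum]
    exact sum_congr rfl fun i _ => by ring
  have hsplit : WithLp.toLp 2 (fun k : ZMod q =>
        charTransform (fun χ : DirichletCharacter ℂ q =>
          DirichletCharacter.LFunction χ 1 * ∏ p ∈ S, eulerFactor χ p) k -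
        charTransform (fun χ : DirichletCharacter ℂ q =>
          DirichletCharacter.LFunction χ 1 * ∏ p ∈ S, eulerFactor χ p) (k + m)) =
      ∑ i, c i • v i := by
    ext k
    simp only [hdecomp, WithLp.ofLp_sum, Finset.sum_apply, PiLp.smul_apply, hv, smul_eq_mul,
      mul_sub, sum_sub_distrib]
  have hterm : ∀ i, ‖c i • v i‖ ≤
      √q * (K * (B ^ (-σ) + √(m / q))) * (‖c i‖ * (d i : ℝ) ^ σ) := by
    intro i
    have h1 : (1 : ℝ) ≤ (d i : ℝ) ^ σ := Real.one_le_rpow (by exact_mod_cast hd i) hσ0.le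
    rw [norm_smul]
    calc _ ≤ ‖c i‖ * (√q * (K * ((d i : ℝ) ^ σ * B ^ (-σ) + (d i : ℝ) ^ σ * √(m / q)))) := by
          gcongr
          refine (hK q B m hB hm hmq hdvd (d i) (hd i)).trans ?_
          gcongr
          exact le_mul_of_one_le_left (Real.sqrt_nonneg _) h1
      _ = _ := by ring
  rw [hsplit]
  refine (norm_sum_le_of_le _ fun i _ => hterm i).trans ?_
  rw [← mul_sum]
  calc _ ≤ √q * (K * (B ^ (-σ) + √(m / q))) * W := by
        gcongr
        exact hsum.trans (prod_one_add_le_exp hσ S)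
    _ = _ := by ring

lemma tendsto_charTransform {q : ℕ} [NeZero q] {ι : Type*} {l : Filter ι}
    {Φ : ι → DirichletCharacter ℂ q → ℂ} {Ψ : DirichletCharacter ℂ q → ℂ}
    (h : ∀ χ, Tendsto (fun i => Φ i χ) l (𝓝 (Ψ χ))) (k : ZMod q) :
    Tendsto (fun i => charTransform (Φ i) k) l (𝓝 (charTransform Ψ k)) :=
  (tendsto_finsetSum _ fun χ _ => ((h χ).const_mul _).const_mul _).const_mul _

lemma exists_sum_norm_shift_sub_sq_le {σ : ℝ} (hσ0 : 0 < σ) (hσ : σ < 1 / 2) :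
    ∃ K : ℝ, 0 ≤ K ∧ ∀ (q : ℕ) [Fact q.Prime] (B : ℝ) (m : ℕ), 2 ≤ B → 1 ≤ m → m < q →
      (∀ n : ℕ, 1 ≤ n → (n : ℝ) ≤ B → n ∣ m) →
      ∑ k : ZMod q, ‖charTransform (fun χ : DirichletCharacter ℂ q =>
          DirichletCharacter.LFunction χ 1 * Aq q χ) k -
        charTransform (fun χ : DirichletCharacter ℂ q =>
          DirichletCharacter.LFunction χ 1 * Aq q χ) (k + m)‖ ^ 2 ≤
      q * (K * (B ^ (-(2 * σ)) + m / q)) := by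
  obtain ⟨K, hK0, hK⟩ := exists_norm_shift_sub_prod_le hσ0 hσ
  refine ⟨2 * K ^ 2, by positivity, fun q _ B m hB hm hmq hdvd => ?_⟩
  have hB0 : (0 : ℝ) < B := by linarith
  have hlim := fun k : ZMod q => tendsto_charTransform (fun χ : DirichletCharacter ℂ q =>
    (tendsto_prod_eulerFactor χ).const_mul (DirichletCharacter.LFunction χ 1)) k
  refine le_of_tendsto' (tendsto_finsetSum univ fun k _ =>
    (((hlim k).sub (hlim (k + m))).norm.pow 2)) fun S => ?_
  have h := hK q B m hB hm hmq hdvd S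
  rw [EuclideanSpace.norm_eq] at h
  refine (Real.sqrt_le_left (by positivity)).1 h |>.trans ?_
  rw [mul_pow, mul_pow, Real.sq_sqrt (Nat.cast_nonneg q)]
  have h1 : (B ^ (-σ)) ^ 2 = B ^ (-(2 * σ)) := by
    rw [← Real.rpow_natCast, ← Real.rpow_mul hB0.le]
    push_cast
    ring_nf
  have h2 : √(m / q : ℝ) ^ 2 = m / q := Real.sq_sqrt (by positivity)
  calc (q : ℝ) * (K ^ 2 * (B ^ (-σ) + √(m / q)) ^ 2)
      ≤ q * (K ^ 2 * (2 * ((B ^ (-σ)) ^ 2 + √(m / q) ^ 2))) := by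
        gcongr
        exact add_sq_le
    _ = _ := by rw [h1, h2]; ring

lemma Cfun_eq_re_charTransform {q : ℕ} [NeZero q] (k : ℤ) :
    Cfun q k = (charTransform (fun χ : DirichletCharacter ℂ q =>
      DirichletCharacter.LFunction χ 1 * Aq q χ) (k : ZMod q)).re := by
  rw [Cfun, dif_neg (NeZero.ne q), charTransform]
  simp only [mul_assoc]

lemma sum_range_Cfun_sub_sq_le {q : ℕ} [NeZero q] (m : ℕ) :
    ∑ k ∈ range q, |Cfun q k - Cfun q (k + m)| ^ 2 ≤
      ∑ k : ZMod q, ‖charTransform (fun χ : DirichletCharacter ℂ q =>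
          DirichletCharacter.LFunction χ 1 * Aq q χ) k -
        charTransform (fun χ : DirichletCharacter ℂ q =>
          DirichletCharacter.LFunction χ 1 * Aq q χ) (k + m)‖ ^ 2 := by
  have h := sum_range_mul_zmod (q := q) (fun k : ℕ => |Cfun q k - Cfun q (k + m)| ^ 2) 1
  rw [mul_one, sum_range_one] at h
  rw [h]
  refine sum_le_sum fun k _ => ?_
  rw [Cfun_eq_re_charTransform, Cfun_eq_re_charTransform, ← Complex.sub_re]
  have hk : (((q * 0 + k.val : ℕ) : ℤ) : ZMod q) = k := by simp
  have hkm : ((((q * 0 + k.val : ℕ) : ℤ) + m : ℤ) : ZMod q) = k + m := by simp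
  rw [hk, hkm]
  exact pow_le_pow_left₀ (abs_nonneg _) (Complex.abs_re_le_norm _) 2

end Conclusion

/-- Almost periodicity of `C(k)` (Theorem 1, part 5). -/
theorem almost_periodicity_C :
    ∀ ε : ℝ, 0 < ε → ∃ A : ℝ, ∀ q : ℕ, q.Prime → Odd q →
    ∀ B : ℝ, 2 ≤ B → ∀ m : ℤ, 1 ≤ m → (m : ℝ) ≤ (q : ℝ) / 4 →
    (∀ n : ℕ, 1 ≤ n → (n : ℝ) ≤ B → (n : ℤ) ∣ m) →
      (1 / q : ℝ) * ∑ k ∈ Finset.range q, |Cfun q k - Cfun q (k + m)| ^ 2 ≤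
        A * (B ^ (-1 + ε) + (m : ℝ) / q * Real.log B) := by
  intro ε hε
  set σ : ℝ := (1 - min ε (1 / 2)) / 2 with hσ
  have hmin0 : 0 < min ε (1 / 2) := lt_min hε (by norm_num)
  have hmin1 : min ε (1 / 2) ≤ 1 / 2 := min_le_right _ _
  obtain ⟨K, hK0, hK⟩ := exists_sum_norm_shift_sub_sq_le (σ := σ) (by linarith) (by linarith)
  have hlog2 : 0 < Real.log 2 := Real.log_pos one_lt_two
  have hlog2' : Real.log 2 ≤ 1 := Real.log_two_lt_d9.le.trans (by norm_num)
  refine ⟨K / Real.log 2, fun q hqp _ B hB m hm hmq hdvd => ?_⟩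
  have : Fact q.Prime := ⟨hqp⟩
  have hq : (0 : ℝ) < q := by exact_mod_cast hqp.pos
  lift m to ℕ using (by linarith)
  rw [Int.cast_natCast] at hmq ⊢
  have hm1 : 1 ≤ m := by exact_mod_cast hm
  have hmlt : m < q := by
    have : (m : ℝ) < q := by linarith
    exact_mod_cast this
  have h1 := (sum_range_Cfun_sub_sq_le m).trans
    (hK q B m hB hm1 hmlt fun n hn hnB => by exact_mod_cast hdvd n hn hnB)
  have h2 : B ^ (-(2 * σ)) ≤ B ^ (-1 + ε) :=
    Real.rpow_le_rpow_of_exponent_le (by linarith) (by rw [hσ]; linarith [min_le_left ε (1 / 2)])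
  have h3 : Real.log 2 ≤ Real.log B := Real.log_le_log two_pos hB
  have h4 : 0 ≤ (m : ℝ) / q := by positivity
  have h5 : 0 ≤ B ^ (-1 + ε) := by positivity
  calc _ ≤ (1 / q : ℝ) * (q * (K * (B ^ (-(2 * σ)) + m / q))) := by gcongr
    _ = K / Real.log 2 * (Real.log 2 * B ^ (-(2 * σ)) + m / q * Real.log 2) := by field_simp
    _ ≤ K / Real.log 2 * (1 * B ^ (-1 + ε) + m / q * Real.log B) := by gcongr
    _ = _ := by rw [one_mul]
end

section
/- For every ε > 0 there exists q₀ such that for every prime q ≥ q₀ there exists an integer t with 1 ≤ t ≤ q−1 such that the (real) number πi·ŝ_q(t) satisfies −πi·ŝ_q(−t) = πi·ŝ_q(t) ≥ (e^γ/4 − ε) log log q, where γ is the Euler–Mascheroni constant. -/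
open scoped Classical Real
open Complex MeasureTheory

/-- The Dedekind sum `s_q(a)`. -/
noncomputable def dedekindSum (q : ℕ) (a : ℤ) : ℝ :=
  ∑ x ∈ Finset.range q, saw ((x : ℝ) / q) * saw ((a * x : ℝ) / q)

/-- The discrete Fourier transform `ŝ_q(t)` of the Dedekind sum. -/
noncomputable def shat (q : ℕ) (t : ℤ) : ℂ :=
  (1 / (q : ℂ)) * ∑ a ∈ Finset.range q,
    (dedekindSum q a : ℂ) * Complex.exp (2 * Real.pi * Complex.I * (a * t) / q)

/-- The first periodised Bernoulli function. -/
noncomputable def bern (x : ℝ) : ℝ := Int.fract x - 1 / 2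

lemma abs_bern_le (x : ℝ) : |bern x| ≤ 1 / 2 := by
  have h0 := Int.fract_nonneg x
  have h1 := (Int.fract_lt_one x).le
  rw [abs_le]; unfold bern; constructor <;> linarith

lemma bern_add_int (x : ℝ) (n : ℤ) : bern (x + n) = bern x := by simp [bern]

lemma measurable_bern : Measurable bern := measurable_fract.sub_const _

lemma intervalIntegrable_bern_mul_bern (c d r s u v : ℝ) :
    IntervalIntegrable (fun x => bern (c * x + r) * bern (d * x + s)) volume u v := by
  refine (intervalIntegrable_const (c := (1 : ℝ))).mono_fun ?_ ?_
  · refine Measurable.aestronglyMeasurable ?_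
    exact (measurable_bern.comp (by fun_prop)).mul (measurable_bern.comp (by fun_prop))
  · refine Filter.Eventually.of_forall fun x => ?_
    have h1 := abs_bern_le (c * x + r)
    have h2 := abs_bern_le (d * x + s)
    simp only [Real.norm_eq_abs, abs_mul, abs_one]
    nlinarith [abs_nonneg (bern (c * x + r)), abs_nonneg (bern (d * x + s))]

lemma sum_range_natCast_zmod {q : ℕ} [NeZero q] {A : Type*} [AddCommMonoid A] (g : ZMod q → A) :
    ∑ k ∈ Finset.range q, g (k : ZMod q) = ∑ z, g z := by
  refine Finset.sum_bij' (fun k _ => ((k : ℕ) : ZMod q)) (fun z _ => z.val) ?_ ?_ ?_ ?_ ?_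
  · simp
  · intro z _; simpa using ZMod.val_lt z
  · intro k hk; exact ZMod.val_cast_of_lt (by simpa using hk)
  · intro z _; simp
  · simp

lemma sum_range_affine_of_periodic {a : ℕ} (ha : 0 < a) (c m : ℤ) (hc : IsCoprime c (a : ℤ))
    (f : ℤ → ℝ) (hf : Function.Periodic f (a : ℤ)) :
    ∑ k ∈ Finset.range a, f (c * k + m) = ∑ k ∈ Finset.range a, f k := by
  have : NeZero a := ⟨ha.ne'⟩
  have key : ∀ n : ℤ, f n = f (((n : ZMod a).val : ℕ) : ℤ) := by
    intro n
    rw [ZMod.val_intCast, Int.emod_def]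
    have := hf.sub_zsmul_eq (x := n) (n / a)
    simp only [smul_eq_mul] at this
    rw [mul_comm, this]
  set g : ZMod a → ℝ := fun z => f ((z.val : ℕ) : ℤ) with hg
  have h1 : ∀ k : ℕ, f (c * k + m) = g ((c : ZMod a) * (k : ZMod a) + (m : ZMod a)) := by
    intro k; rw [key]; simp [hg]
  have h2 : ∀ k : ℕ, f k = g (k : ZMod a) := by
    intro k; rw [key k]; simp only [hg, Int.cast_natCast]
  simp_rw [h1, h2]
  rw [sum_range_natCast_zmod (fun z => g ((c : ZMod a) * z + (m : ZMod a))),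
    sum_range_natCast_zmod g]
  obtain ⟨u, v, huv⟩ := hc
  have hu : (u : ZMod a) * (c : ZMod a) = 1 := by
    have := congrArg (Int.cast : ℤ → ZMod a) huv
    simpa using this
  refine Fintype.sum_bijective (fun z : ZMod a => (c : ZMod a) * z + (m : ZMod a)) ?_ _ _
    (fun _ => rfl)
  refine Finite.injective_iff_bijective.mp fun x y hxy => ?_
  have h3 : (c : ZMod a) * x = c * y := by simpa using hxy
  calc x = u * c * x := by rw [hu, one_mul]
    _ = u * c * y := by rw [mul_assoc, h3, mul_assoc]
    _ = y := by rw [hu, one_mul]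

lemma sum_bern_add_div {a : ℕ} (ha : 0 < a) (z : ℝ) :
    ∑ k ∈ Finset.range a, bern (z + k / a) = bern (a * z) := by
  have ha' : (0 : ℝ) < a := by exact_mod_cast ha
  set m : ℤ := ⌊(a : ℝ) * z⌋ with hm
  set w : ℝ := z - m / a with hw
  have hw0 : (a : ℝ) * w = Int.fract (a * z) := by
    rw [hw, Int.fract, mul_sub, mul_div_cancel₀ _ ha'.ne']
  have h := sum_range_affine_of_periodic ha 1 m isCoprime_one_left
    (fun n : ℤ => bern (w + n / a)) (by
      intro n
      have : w + ((n + (a : ℤ) : ℤ) : ℝ) / a = w + n / a + (1 : ℤ) := by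
        push_cast; field_simp; ring
      simp only [this, bern_add_int])
  have e1 : ∀ k : ℕ, w + ((1 * (k : ℤ) + m : ℤ) : ℝ) / a = z + k / a := by
    intro k; rw [hw]; push_cast; ring
  simp only [e1] at h
  rw [h]
  have e2 : ∀ k ∈ Finset.range a, bern (w + ((k : ℤ) : ℝ) / a) = w + k / a - 1 / 2 := by
    intro k hk
    have hk' : (k : ℝ) + 1 ≤ a := by exact_mod_cast Finset.mem_range.mp hk
    unfold bern
    have h0 : 0 ≤ w := by
      have := Int.fract_nonneg ((a : ℝ) * z)
      rw [← hw0] at this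
      exact nonneg_of_mul_nonneg_right this ha'
    rw [Int.fract_eq_self.mpr]
    · simp
    · refine ⟨by simp only [Int.cast_natCast]; positivity, ?_⟩
      have h1 := Int.fract_lt_one ((a : ℝ) * z)
      rw [← hw0] at h1
      have : w + ((k : ℤ) : ℝ) / a = (a * w + k) / a := by
        push_cast; field_simp
      rw [this, div_lt_one ha']; linarith
  rw [Finset.sum_congr rfl e2]
  have e3 : ∑ k ∈ Finset.range a, (k : ℝ) = a * (a - 1) / 2 := by
    clear * -
    induction a with
    | zero => simp
    | succ n ih => rw [Finset.sum_range_succ, ih]; push_cast; ring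
  rw [Finset.sum_sub_distrib, Finset.sum_add_distrib, ← Finset.sum_div, e3]
  simp only [Finset.sum_const, Finset.card_range, nsmul_eq_mul]
  rw [hw0, bern]; field_simp; ring

lemma integral_comp_nat_mul_of_periodic {f : ℝ → ℝ} (hf : Function.Periodic f 1)
    (hint : ∀ u v : ℝ, IntervalIntegrable f volume u v) {g : ℕ} (hg : 0 < g) : ∫ x in (0 : ℝ)..1, f (g * x) = ∫ x in (0 : ℝ)..1, f x := by
  have hg' : (g : ℝ) ≠ 0 := by exact_mod_cast hg.ne'
  rw [intervalIntegral.integral_comp_mul_left _ hg']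
  have := hf.intervalIntegral_add_zsmul_eq g 0 hint
  simp at this ⊢
  rw [this]; field_simp

lemma integral_comp_add_of_periodic {f : ℝ → ℝ} (hf : Function.Periodic f 1) (c : ℝ) :
    ∫ x in (0 : ℝ)..1, f (x + c) = ∫ x in (0 : ℝ)..1, f x := by
  rw [intervalIntegral.integral_comp_add_right]
  have := hf.intervalIntegral_add_eq c 0
  simpa [add_comm] using this

lemma periodic_bern_mul_bern (a b : ℕ) :
    Function.Periodic (fun x : ℝ => bern (a * x) * bern (b * x)) 1 := by
  intro x
  have h : ∀ n : ℕ, bern (n * (x + 1)) = bern (n * x) := fun n => by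
    rw [← bern_add_int (n * x) n]; push_cast; ring_nf
  simp only [h]

lemma intervalIntegrable_bern_nat_mul (a b : ℕ) (u v : ℝ) :
    IntervalIntegrable (fun x => bern (a * x) * bern (b * x)) volume u v := by
  simpa using intervalIntegrable_bern_mul_bern a b 0 0 u v

lemma integral_bern_mul_bern_eq_div {a b : ℕ} (ha : 0 < a) (hab : a.Coprime b) :
    ∫ x in (0 : ℝ)..1, bern (a * x) * bern (b * x) =
      (∫ x in (0 : ℝ)..1, bern x * bern (b * x)) / a := by
  have ha' : (0 : ℝ) < a := by exact_mod_cast ha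
  have h1 : ∀ k ∈ Finset.range a, ∫ x in (0 : ℝ)..1, bern (a * x) * bern (b * x + b * k / a) =
      ∫ x in (0 : ℝ)..1, bern (a * x) * bern (b * x) := by
    intro k _
    rw [← integral_comp_add_of_periodic (periodic_bern_mul_bern a b) (k / a)]
    refine intervalIntegral.integral_congr fun x _ => ?_
    have : (a : ℝ) * (x + k / a) = a * x + (k : ℤ) := by push_cast; field_simp
    simp only [this, bern_add_int]
    congr 2; ring
  have h2 := Finset.sum_congr rfl h1
  rw [← intervalIntegral.integral_finsetSum] at h2
  · have h3 : ∀ x : ℝ, ∑ k ∈ Finset.range a, bern (a * x) * bern (b * x + b * k / a) =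
        bern (1 * (a * x)) * bern (b * (a * x)) := by
      intro x
      rw [← Finset.mul_sum]
      have h4 := sum_range_affine_of_periodic ha b 0
        (by rw [Nat.isCoprime_iff_coprime]; exact hab.symm)
        (fun n : ℤ => bern (b * x + n / a)) (by
          intro n
          have : (b : ℝ) * x + ((n + (a : ℤ) : ℤ) : ℝ) / a = b * x + n / a + (1 : ℤ) := by
            push_cast; field_simp; ring
          simp only [this, bern_add_int])
      have h5 := sum_bern_add_div ha (b * x)
      simp only [Int.cast_natCast] at h4
      rw [h5] at h4
      simp only [add_zero, Int.cast_mul, Int.cast_natCast] at h4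
      rw [h4, one_mul]; congr 2; ring
    simp only [h3] at h2
    have h6 := integral_comp_nat_mul_of_periodic (periodic_bern_mul_bern 1 b)
      (intervalIntegrable_bern_nat_mul 1 b) ha
    simp only [Nat.cast_one] at h6
    rw [h6] at h2
    simp only [one_mul, Finset.sum_const, Finset.card_range, nsmul_eq_mul] at h2
    rw [h2, mul_div_cancel_left₀ _ ha'.ne']
  · intro k _
    simpa using intervalIntegrable_bern_mul_bern a b 0 (b * k / a) 0 1

lemma integral_bern_mul_self : ∫ x in (0 : ℝ)..1, bern x * bern x = 1 / 12 := by
  have : ∫ x in (0 : ℝ)..1, bern x * bern x = ∫ x in (0 : ℝ)..1, (x ^ 2 - x + 1 / 4) := by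
    refine intervalIntegral.integral_congr_ae ?_
    have h1 : ∀ᵐ x : ℝ, x ≠ 1 := by simp [ae_iff, measure_singleton]
    filter_upwards [h1] with x hx hx'
    rw [Set.uIoc_of_le zero_le_one] at hx'
    have : Int.fract x = x :=
      Int.fract_eq_self.mpr ⟨hx'.1.le, lt_of_le_of_ne hx'.2 hx⟩
    rw [bern, this]; ring
  rw [this, intervalIntegral.integral_add, intervalIntegral.integral_sub]
  · simp; norm_num
  all_goals exact Continuous.intervalIntegrable (by fun_prop) _ _

lemma integral_bern_mul_bern {a b : ℕ} (ha : 0 < a) (hb : 0 < b) :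
    ∫ x in (0 : ℝ)..1, bern (a * x) * bern (b * x) = (a.gcd b : ℝ) ^ 2 / (12 * a * b) := by
  obtain ⟨g, a', b', hg, hco, rfl, rfl⟩ := Nat.exists_coprime' (m := a) (n := b)
    (Nat.gcd_pos_of_pos_left _ ha)
  have ha' : 0 < a' := Nat.pos_of_mul_pos_right ha
  have hb' : 0 < b' := Nat.pos_of_mul_pos_right hb
  have h1 := integral_comp_nat_mul_of_periodic (periodic_bern_mul_bern a' b')
    (intervalIntegrable_bern_nat_mul a' b') hg
  have h2 : ∀ x : ℝ, bern ((a' * g : ℕ) * x) * bern ((b' * g : ℕ) * x) =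
      bern (a' * (g * x)) * bern (b' * (g * x)) := by
    intro x; push_cast; rw [mul_assoc, mul_assoc]
  simp only [h2]
  rw [h1, integral_bern_mul_bern_eq_div ha' hco]
  have h3 := integral_bern_mul_bern_eq_div hb' (Nat.coprime_one_right b')
  simp only [Nat.cast_one, one_mul] at h3
  rw [integral_bern_mul_self] at h3
  have h4 : ∫ x in (0 : ℝ)..1, bern x * bern (b' * x) =
      ∫ x in (0 : ℝ)..1, bern (b' * x) * bern x := by
    simp only [mul_comm]
  rw [h4, h3, Nat.gcd_mul_right, hco.gcd_eq_one]
  have : (0 : ℝ) < a' := by exact_mod_cast ha'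
  have : (0 : ℝ) < b' := by exact_mod_cast hb'
  have : (0 : ℝ) < g := by exact_mod_cast hg
  push_cast; field_simp

lemma abs_bern_sub_le {x y z : ℝ} (hxy : x ≤ y) (hyz : y ≤ z) :
    |bern y - bern x| ≤ (z - x) + (⌊z⌋ - ⌊x⌋) := by
  have h1 : (⌊x⌋ : ℝ) ≤ ⌊y⌋ := by exact_mod_cast Int.floor_mono hxy
  have h2 : (⌊y⌋ : ℝ) ≤ ⌊z⌋ := by exact_mod_cast Int.floor_mono hyz
  unfold bern Int.fract
  rw [abs_le]; constructor <;> linarith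

lemma integral_bern_le_sum {q : ℕ} (hq : 0 < q) (a b : ℕ) :
    q * (∫ x in (0 : ℝ)..1, bern (a * x) * bern (b * x)) - (a + b) ≤
      ∑ x ∈ Finset.range q, bern (a * (x / q)) * bern (b * (x / q)) := by
  have hq' : (0 : ℝ) < q := by exact_mod_cast hq
  set t : ℕ → ℝ := fun x => (x : ℝ) / q with ht
  have hint := intervalIntegrable_bern_nat_mul a b
  have hsum := intervalIntegral.sum_integral_adjacent_intervals (n := q) (a := t)
    (fun k _ => hint (t k) (t (k + 1)))
  have t0 : t 0 = 0 := by simp [ht]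
  have tq : t q = 1 := by simp [ht, hq'.ne']
  have hstep : ∀ k, t (k + 1) - t k = 1 / q := by intro k; simp only [ht]; push_cast; ring
  rw [t0, tq] at hsum
  let E : ℕ → ℕ → ℝ := fun c k => (c * t (k + 1) - c * t k) + (⌊c * t (k + 1)⌋ - ⌊c * t k⌋)
  have hE : ∀ c : ℕ, ∑ k ∈ Finset.range q, E c k = 2 * c := by
    intro c
    simp only [E]
    rw [Finset.sum_add_distrib, Finset.sum_range_sub (fun k => (c : ℝ) * t k),
      Finset.sum_range_sub (fun k => (⌊(c : ℝ) * t k⌋ : ℝ)), t0, tq]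
    simp; ring
  have hcell : ∀ k ∈ Finset.range q,
      ∫ x in t k..t (k + 1), bern (a * x) * bern (b * x) ≤
        (bern (a * t k) * bern (b * t k) + (E a k + E b k) / 2) / q := by
    intro k _
    have hle : t k ≤ t (k + 1) := by
      have := hstep k
      have : 0 < 1 / (q : ℝ) := by positivity
      linarith
    have := intervalIntegral.integral_mono_on hle (hint _ _)
      (intervalIntegrable_const (c := bern (a * t k) * bern (b * t k) + (E a k + E b k) / 2)) (by
        intro x hx
        have hA := abs_bern_sub_le (mul_le_mul_of_nonneg_left hx.1 (Nat.cast_nonneg (α := ℝ) a))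
          (mul_le_mul_of_nonneg_left hx.2 (Nat.cast_nonneg a))
        have hB := abs_bern_sub_le (mul_le_mul_of_nonneg_left hx.1 (Nat.cast_nonneg (α := ℝ) b))
          (mul_le_mul_of_nonneg_left hx.2 (Nat.cast_nonneg b))
        have h1 := abs_bern_le (a * x)
        have h2 := abs_bern_le (b * t k)
        have e : bern (a * x) * bern (b * x) - bern (a * t k) * bern (b * t k) =
          bern (a * x) * (bern (b * x) - bern (b * t k)) +
            (bern (a * x) - bern (a * t k)) * bern (b * t k) := by ring
        have e1 : bern (a * x) * (bern (b * x) - bern (b * t k)) ≤ E b k / 2 := by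
          refine (le_abs_self _).trans ?_
          rw [abs_mul]
          have := mul_le_mul h1 hB (abs_nonneg _) (by norm_num)
          simp only [E]; linarith
        have e2 : (bern (a * x) - bern (a * t k)) * bern (b * t k) ≤ E a k / 2 := by
          refine (le_abs_self _).trans ?_
          rw [abs_mul, mul_comm]
          have := mul_le_mul h2 hA (abs_nonneg _) (by norm_num)
          simp only [E]; linarith
        linarith)
    refine this.trans (le_of_eq ?_)
    rw [intervalIntegral.integral_const, hstep, smul_eq_mul]; ring
  have hfin := Finset.sum_le_sum hcell
  rw [hsum, ← Finset.sum_div, Finset.sum_add_distrib, ← Finset.sum_div, Finset.sum_add_distrib,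
    hE, hE, le_div_iff₀ hq'] at hfin
  linarith

lemma saw_add_int (x : ℝ) (n : ℤ) : saw (x + n) = saw x := by simp [saw]

lemma saw_neg (x : ℝ) : saw (-x) = -saw x := by
  unfold saw
  by_cases h : Int.fract x = 0
  · simp [h, Int.fract_neg_eq_zero.mpr h]
  · rw [if_neg h, if_neg (by rwa [Int.fract_neg_eq_zero]), Int.fract_neg h]; ring

/-- The function `x ↦ saw (x / q)` on residues modulo `q`. -/
noncomputable def sawMod (q : ℕ) (z : ZMod q) : ℝ := saw ((z.val : ℝ) / q)

/-- The Dedekind sum as a function on residues modulo `q`. -/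
noncomputable def dedekindMod (q : ℕ) [NeZero q] (a : ZMod q) : ℝ :=
  ∑ x : ZMod q, sawMod q x * sawMod q (a * x)

section ZModLemmas

variable {q : ℕ} [NeZero q]

lemma saw_intCast_div (n : ℤ) : saw ((n : ℝ) / q) = sawMod q (n : ZMod q) := by
  have hq : (q : ℝ) ≠ 0 := Nat.cast_ne_zero.mpr (NeZero.ne q)
  have h1 : (((n : ZMod q).val : ℕ) : ℤ) = n % q := ZMod.val_intCast n
  have h2 : (((n : ZMod q).val : ℕ) : ℝ) = ((n % q : ℤ) : ℝ) := by rw [← h1]; simp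
  have h3 : (n : ℝ) = ((n % q : ℤ) : ℝ) + q * ((n / q : ℤ) : ℝ) := by
    exact_mod_cast (Int.emod_add_mul_ediv n q).symm
  rw [sawMod, h2, ← saw_add_int (((n % q : ℤ) : ℝ) / q) (n / q)]
  congr 1
  rw [h3]; field_simp

lemma dedekindSum_eq_dedekindMod (a : ℤ) : dedekindSum q a = dedekindMod q (a : ZMod q) := by
  rw [dedekindSum, dedekindMod, ← sum_range_natCast_zmod]
  refine Finset.sum_congr rfl fun x _ => ?_
  have h1 := saw_intCast_div (q := q) (x : ℤ)
  have h2 := saw_intCast_div (q := q) (a * x : ℤ)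
  push_cast at h1 h2
  rw [h1, h2]

lemma shat_eq_sum_zmod (t : ℤ) :
    shat q t = (1 / (q : ℂ)) * ∑ a : ZMod q,
      (dedekindMod q a : ℂ) * ZMod.stdAddChar (a * (t : ZMod q)) := by
  rw [shat, ← sum_range_natCast_zmod]
  congr 1
  refine Finset.sum_congr rfl fun a _ => ?_
  have h1 := dedekindSum_eq_dedekindMod (q := q) (a : ℤ)
  have h2 := ZMod.stdAddChar_coe (N := q) ((a : ℤ) * t)
  push_cast at h1 h2
  rw [h1, h2]

lemma sawMod_neg (z : ZMod q) : sawMod q (-z) = -sawMod q z := by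
  have h1 := saw_intCast_div (q := q) (-(z.val : ℤ))
  push_cast at h1
  rw [ZMod.natCast_zmod_val] at h1
  rw [← h1, neg_div, saw_neg, sawMod]

lemma dedekindMod_neg (a : ZMod q) : dedekindMod q (-a) = -dedekindMod q a := by
  simp only [dedekindMod, neg_mul, sawMod_neg, mul_neg, Finset.sum_neg_distrib]

lemma shat_neg (t : ℤ) : shat q (-t) = -shat q t := by
  rw [shat_eq_sum_zmod, shat_eq_sum_zmod, ← mul_neg, ← Finset.sum_neg_distrib]
  congr 1
  refine Fintype.sum_equiv (Equiv.neg _) _ _ fun a => ?_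
  simp [dedekindMod_neg]

lemma sum_fejer_mul_char (J : ℕ) (φ : ℝ) (b : ZMod q) :
    ∑ u : ZMod q,
      ((Complex.normSq (∑ k ∈ Finset.range J,
        Complex.exp (k * φ * I) * ZMod.stdAddChar ((k : ZMod q) * u)) : ℝ) : ℂ) *
          ZMod.stdAddChar (b * u) =
      ∑ k ∈ Finset.range J, ∑ l ∈ Finset.range J, Complex.exp (((k : ℝ) - l) * φ * I) *
        if (k : ZMod q) - (l : ZMod q) + b = 0 then (q : ℂ) else 0 := by
  have h1 : ∀ u : ZMod q,
      ((Complex.normSq (∑ k ∈ Finset.range J,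
        Complex.exp (k * φ * I) * ZMod.stdAddChar ((k : ZMod q) * u)) : ℝ) : ℂ) *
          ZMod.stdAddChar (b * u) =
      ∑ k ∈ Finset.range J, ∑ l ∈ Finset.range J, Complex.exp (((k : ℝ) - l) * φ * I) *
        ZMod.stdAddChar (u * ((k : ZMod q) - (l : ZMod q) + b)) := by
    intro u
    rw [← Complex.mul_conj, map_sum, Finset.sum_mul_sum, Finset.sum_mul]
    refine Finset.sum_congr rfl fun k _ => ?_
    rw [Finset.sum_mul]
    refine Finset.sum_congr rfl fun l _ => ?_
    have e1 : u * ((k : ZMod q) - (l : ZMod q) + b) =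
        (k : ZMod q) * u + (-((l : ZMod q) * u)) + b * u := by ring
    have e2 : ((k : ℝ) - l : ℂ) * φ * I = k * φ * I + (-(l * φ * I)) := by push_cast; ring
    rw [e1, e2, AddChar.map_add_eq_mul, AddChar.map_add_eq_mul, AddChar.map_neg_eq_conj,
      Complex.exp_add, map_mul (starRingEnd ℂ), ← Complex.exp_conj]
    simp only [map_mul, Complex.conj_I, Complex.conj_ofReal, map_natCast, mul_neg]
    ring
  rw [Finset.sum_congr rfl fun u _ => h1 u, Finset.sum_comm]
  refine Finset.sum_congr rfl fun k _ => ?_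
  rw [Finset.sum_comm]
  refine Finset.sum_congr rfl fun l _ => ?_
  rw [← Finset.mul_sum, AddChar.sum_mulShift _ (ZMod.isPrimitive_stdAddChar q), ZMod.card]
  push_cast; rfl

lemma sum_fejer {J : ℕ} (hJ : J ≤ q) (φ : ℝ) :
    ∑ u : ZMod q, Complex.normSq (∑ k ∈ Finset.range J,
        Complex.exp (k * φ * I) * ZMod.stdAddChar ((k : ZMod q) * u)) = q * J := by
  have h := sum_fejer_mul_char (q := q) J φ 0
  have h2 : ∀ k ∈ Finset.range J, ∑ l ∈ Finset.range J,
      Complex.exp (((k : ℝ) - l) * φ * I) *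
        (if (k : ZMod q) - (l : ZMod q) + 0 = 0 then (q : ℂ) else 0) = q := by
    intro k hk
    rw [Finset.sum_eq_single k]
    · simp
    · intro l hl hlk
      rw [if_neg, mul_zero]
      rw [add_zero, sub_eq_zero]
      intro h3
      have h4 := congrArg ZMod.val h3
      rw [ZMod.val_cast_of_lt (lt_of_lt_of_le (Finset.mem_range.mp hk) hJ),
        ZMod.val_cast_of_lt (lt_of_lt_of_le (Finset.mem_range.mp hl) hJ)] at h4
      exact hlk h4.symm
    · intro h; exact absurd hk h
  rw [Finset.sum_congr rfl h2] at h
  simp only [zero_mul, AddChar.map_zero_eq_one, mul_one, Finset.sum_const, Finset.card_range,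
    nsmul_eq_mul] at h
  have h5 : ((∑ u : ZMod q, Complex.normSq (∑ k ∈ Finset.range J,
        Complex.exp (k * φ * I) * ZMod.stdAddChar ((k : ZMod q) * u)) : ℝ) : ℂ) =
        ((q * J : ℝ) : ℂ) := by
    rw [Complex.ofReal_sum, h]; push_cast; ring
  exact_mod_cast h5

end ZModLemmas

lemma sum_sin_mul_dedekindMod_le {q : ℕ} [Fact q.Prime] {L J : ℕ} (hL : (L : ZMod q) ≠ 0)
    (hJ : J ≤ q) {M : ℝ} (hM : ∀ t : ℤ, ((Real.pi : ℂ) * I * shat q t).re ≤ M) (φ : ℝ) :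
    ∑ k ∈ Finset.range J, ∑ l ∈ Finset.range J,
      dedekindMod q (((l : ZMod q) - (k : ZMod q)) / L) * Real.sin (((l : ℝ) - k) * φ) ≤
        M * q * J / Real.pi := by
  have hq : (q : ℂ) ≠ 0 := Nat.cast_ne_zero.mpr (NeZero.ne q)
  set K : ZMod q → ℝ := fun u => Complex.normSq (∑ k ∈ Finset.range J,
        Complex.exp (k * φ * I) * ZMod.stdAddChar ((k : ZMod q) * u)) with hK
  have h1 : ∑ u : ZMod q, K u * ((Real.pi : ℂ) * I * shat q (L * u.val : ℤ)).re ≤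
      ∑ u : ZMod q, K u * M :=
    Finset.sum_le_sum fun u _ => mul_le_mul_of_nonneg_left (hM _) (Complex.normSq_nonneg _)
  rw [← Finset.sum_mul, sum_fejer hJ] at h1
  have h2 : ∑ u : ZMod q, (K u : ℂ) * ((Real.pi : ℂ) * I * shat q (L * u.val : ℤ)) =
      ∑ k ∈ Finset.range J, ∑ l ∈ Finset.range J, (Real.pi : ℂ) * I *
        (Complex.exp (((k : ℝ) - l) * φ * I) * dedekindMod q (((l : ZMod q) - (k : ZMod q)) / L)) := by
    calc _ = ∑ a : ZMod q, (Real.pi : ℂ) * I * (1 / q) * dedekindMod q a *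
          ∑ u : ZMod q, (K u : ℂ) * ZMod.stdAddChar ((a * (L : ZMod q)) * u) := by
          simp only [shat_eq_sum_zmod, Finset.mul_sum]
          rw [Finset.sum_comm]
          refine Finset.sum_congr rfl fun a _ => Finset.sum_congr rfl fun u _ => ?_
          push_cast
          rw [ZMod.natCast_zmod_val, mul_assoc a (L : ZMod q) u]
          ring
      _ = ∑ a : ZMod q, ∑ k ∈ Finset.range J, ∑ l ∈ Finset.range J,
          (Real.pi : ℂ) * I * (1 / q) * dedekindMod q a *
            (Complex.exp (((k : ℝ) - l) * φ * I) *
              if (k : ZMod q) - (l : ZMod q) + a * (L : ZMod q) = 0 then (q : ℂ) else 0) := by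
          refine Finset.sum_congr rfl fun a _ => ?_
          rw [sum_fejer_mul_char]
          simp only [Finset.mul_sum]
      _ = _ := by
          rw [Finset.sum_comm]
          refine Finset.sum_congr rfl fun k _ => ?_
          rw [Finset.sum_comm]
          refine Finset.sum_congr rfl fun l _ => ?_
          rw [Finset.sum_eq_single (((l : ZMod q) - (k : ZMod q)) / L)]
          · rw [if_pos (by field_simp; ring)]
            field_simp
          · intro a _ ha
            rw [if_neg, mul_zero, mul_zero]
            intro h
            apply ha
            rw [eq_div_iff hL]
            linear_combination h
          · simp
  have h3 := congrArg Complex.re h2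
  simp only [Complex.re_sum, Complex.re_ofReal_mul] at h3
  rw [h3] at h1
  have h4 : ∀ k l : ℕ, ((Real.pi : ℂ) * I *
        (Complex.exp (((k : ℝ) - l) * φ * I) * dedekindMod q (((l : ZMod q) - (k : ZMod q)) / L))).re =
      Real.pi * (dedekindMod q (((l : ZMod q) - (k : ZMod q)) / L) * Real.sin (((l : ℝ) - k) * φ)) := by
    intro k l
    have e : (((k : ℝ) - l : ℂ) * φ * I) = (((k - l) * φ : ℝ) : ℂ) * I := by push_cast; ring
    have e' : ((l : ℝ) - k) * φ = -((k - l) * φ) := by ring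
    rw [e, e', Complex.exp_mul_I, ← Complex.ofReal_cos, ← Complex.ofReal_sin, Real.sin_neg]
    simp only [Complex.mul_re, Complex.mul_im, Complex.add_re, Complex.add_im, Complex.ofReal_re,
      Complex.ofReal_im, Complex.I_re, Complex.I_im]
    ring
  simp only [mul_assoc (Real.pi : ℂ)] at h4 h1
  simp only [h4, ← Finset.mul_sum] at h1
  rw [le_div_iff₀ Real.pi_pos]
  linarith

lemma integral_exp_neg_mul_sin {c : ℝ} (hc : 0 < c) (h : ℝ) :
    IntegrableOn (fun x : ℝ => Real.exp (-c * x) * Real.sin (h * x)) (Set.Ioi 0) ∧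
    ∫ x in Set.Ioi (0 : ℝ), Real.exp (-c * x) * Real.sin (h * x) = h / (c ^ 2 + h ^ 2) := by
  have ha : (-c + h * I : ℂ).re < 0 := by simpa using hc
  have h1 := integrableOn_exp_mul_complex_Ioi ha 0
  have h2 := integral_exp_mul_complex_Ioi ha 0
  have h3 : ∀ x : ℝ, (Complex.exp ((-c + h * I) * x)).im =
      Real.exp (-c * x) * Real.sin (h * x) := by
    intro x
    rw [Complex.exp_im]; simp
  have h4 : ∫ x in Set.Ioi (0 : ℝ), (Complex.exp ((-c + h * I) * x)).im =
      (∫ x in Set.Ioi (0 : ℝ), Complex.exp ((-c + h * I) * x)).im := integral_im h1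
  have h5 := h1.im
  refine ⟨?_, ?_⟩
  · refine h5.congr (Filter.Eventually.of_forall fun x => ?_)
    exact h3 x
  · simp only [h3] at h4
    rw [h4, h2]
    simp [Complex.div_im, Complex.normSq_apply]
    ring_nf

lemma sum_poisson_le_of_sum_sin_le {ι : Type*} (s : Finset ι) (r h : ι → ℝ) {C : ℝ}
    (hC : ∀ φ : ℝ, ∑ i ∈ s, r i * Real.sin (h i * φ) ≤ C) {c : ℝ} (hc : 0 < c) :
    ∑ i ∈ s, r i * (c * h i / (c ^ 2 + h i ^ 2)) ≤ C := by
  have hint : ∀ i ∈ s, IntegrableOn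
      (fun x : ℝ => r i * (Real.exp (-c * x) * Real.sin (h i * x))) (Set.Ioi 0) :=
    fun i _ => (integral_exp_neg_mul_sin hc (h i)).1.const_mul _
  have hexp : IntegrableOn (fun x : ℝ => Real.exp (-c * x)) (Set.Ioi 0) :=
    integrableOn_exp_mul_Ioi (by linarith) 0
  have h1 : ∫ x in Set.Ioi (0 : ℝ), ∑ i ∈ s, r i * (Real.exp (-c * x) * Real.sin (h i * x)) ≤
      ∫ x in Set.Ioi (0 : ℝ), Real.exp (-c * x) * C := by
    refine integral_mono (integrable_finsetSum s hint) (hexp.mul_const C) fun x => ?_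
    have := mul_le_mul_of_nonneg_left (hC x) (Real.exp_pos (-c * x)).le
    rw [Finset.mul_sum] at this
    refine le_trans (le_of_eq (Finset.sum_congr rfl fun i _ => ?_)) this
    ring
  rw [integral_finsetSum _ hint, integral_mul_const, integral_exp_mul_Ioi (by linarith)] at h1
  simp only [integral_const_mul, (integral_exp_neg_mul_sin hc _).2] at h1
  have h2 : ∑ i ∈ s, r i * (c * h i / (c ^ 2 + h i ^ 2)) =
      c * ∑ i ∈ s, r i * (h i / (c ^ 2 + h i ^ 2)) := by
    rw [Finset.mul_sum]
    exact Finset.sum_congr rfl fun i _ => by ring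
  rw [h2]
  have h3 := mul_le_mul_of_nonneg_left h1 hc.le
  refine h3.trans (le_of_eq ?_)
  simp; field_simp

lemma saw_eq_bern {x : ℝ} (hx : Int.fract x ≠ 0) : saw x = bern x := by
  rw [saw, if_neg hx, bern]

lemma fract_mul_div_ne_zero {q h y : ℕ} (hq : q.Prime) (h0 : 0 < h) (hhq : h < q) (y0 : 0 < y)
    (hyq : y < q) : Int.fract ((h : ℝ) * (y / q)) ≠ 0 := by
  intro hf
  rw [Int.fract_eq_zero_iff] at hf
  obtain ⟨n, hn⟩ := hf
  have hq' : (q : ℝ) ≠ 0 := by exact_mod_cast hq.ne_zero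
  have h1 : (n : ℝ) * q = h * y := by rw [hn]; field_simp
  have h2 : n * q = (h * y : ℕ) := by exact_mod_cast h1
  have h3 : q ∣ h * y := by
    rw [← Int.natCast_dvd_natCast, ← h2]; exact Dvd.intro_left _ rfl
  rcases hq.dvd_mul.mp h3 with h4 | h4
  · exact absurd (Nat.le_of_dvd h0 h4) (by omega)
  · exact absurd (Nat.le_of_dvd y0 h4) (by omega)

lemma dedekindMod_div_eq_sum {q : ℕ} [Fact q.Prime] {h L : ℕ} (hL : (L : ZMod q) ≠ 0) :
    dedekindMod q ((h : ZMod q) / L) =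
      ∑ y ∈ Finset.range q, saw ((h : ℝ) * (y / q)) * saw ((L : ℝ) * (y / q)) := by
  have h1 : ∀ n y : ℕ, saw ((n : ℝ) * (y / q)) = sawMod q ((n : ZMod q) * (y : ZMod q)) := by
    intro n y
    have := saw_intCast_div (q := q) (n * y : ℤ)
    push_cast at this
    rw [← this, mul_div_assoc]
  simp only [h1]
  rw [sum_range_natCast_zmod (q := q)
    (fun y => sawMod q ((h : ZMod q) * y) * sawMod q ((L : ZMod q) * y)), dedekindMod]
  refine (Fintype.sum_equiv (Equiv.mulLeft₀ (L : ZMod q) hL) _ _ fun y => ?_).symm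
  simp only [Equiv.mulLeft₀_apply]
  rw [mul_comm (sawMod q _), ← mul_assoc, div_mul_cancel₀ _ hL]

lemma le_dedekindMod_div {q : ℕ} [hq : Fact q.Prime] {h L : ℕ} (h0 : 0 < h) (hhq : h < q)
    (L0 : 0 < L) (hLq : L < q) :
    q * ((h.gcd L : ℝ) ^ 2 / (12 * h * L)) - (h + L + 1) ≤
      dedekindMod q ((h : ZMod q) / L) := by
  have hL : (L : ZMod q) ≠ 0 := by
    rw [Ne, ZMod.natCast_eq_zero_iff]
    exact fun hd => absurd (Nat.le_of_dvd L0 hd) (by omega)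
  have h1 := integral_bern_le_sum hq.out.pos h L
  rw [integral_bern_mul_bern h0 L0] at h1
  rw [dedekindMod_div_eq_sum hL]
  obtain ⟨p, rfl⟩ : ∃ p, q = p + 1 := ⟨q - 1, by have := hq.out.pos; omega⟩
  rw [Finset.sum_range_succ'] at h1 ⊢
  have h2 : ∑ y ∈ Finset.range p, saw ((h : ℝ) * ((y + 1 : ℕ) / (p + 1 : ℕ))) *
        saw ((L : ℝ) * ((y + 1 : ℕ) / (p + 1 : ℕ))) =
      ∑ y ∈ Finset.range p, bern ((h : ℝ) * ((y + 1 : ℕ) / (p + 1 : ℕ))) *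
        bern ((L : ℝ) * ((y + 1 : ℕ) / (p + 1 : ℕ))) := by
    refine Finset.sum_congr rfl fun y hy => ?_
    have hy' := Finset.mem_range.mp hy
    rw [saw_eq_bern (fract_mul_div_ne_zero hq.out h0 hhq (by omega) (by omega)),
      saw_eq_bern (fract_mul_div_ne_zero hq.out L0 hLq (by omega) (by omega))]
  rw [h2]
  have h3 : saw 0 = 0 := by simp [saw]
  have h4 : bern 0 = -(1 / 2) := by simp [bern]
  simp only [Nat.cast_zero, zero_div, mul_zero, h3, h4] at h1 ⊢
  linarith

lemma sum_inv_sq_filter_dvd_le {h L : ℕ} (h0 : 0 < h) (L0 : 0 < L) (N : ℕ) :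
    ∑ n ∈ (Finset.Icc 1 N).filter (fun n => L ∣ h * n), (L : ℝ) / (h * n ^ 2) ≤
      Real.pi ^ 2 / 6 * ((h.gcd L : ℝ) ^ 2 / (h * L)) := by
  obtain ⟨g, h', e, hg, hco, hh, hL⟩ := Nat.exists_coprime' (m := h) (n := L)
    (Nat.gcd_pos_of_pos_left _ h0)
  have hgcd : h.gcd L = g := by rw [hh, hL, Nat.gcd_mul_right, hco.gcd_eq_one, one_mul]
  have e0 : 0 < e := Nat.pos_of_mul_pos_right (hL ▸ L0)
  have hdvd : ∀ n, L ∣ h * n → e ∣ n := by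
    intro n hn
    rw [hh, hL, mul_right_comm] at hn
    exact hco.symm.dvd_of_dvd_mul_left (Nat.dvd_of_mul_dvd_mul_right hg hn)
  have hR : (0 : ℝ) < h := by exact_mod_cast h0
  have eR : (0 : ℝ) < e := by exact_mod_cast e0
  have gR : (0 : ℝ) < g := by exact_mod_cast hg
  have LR : (L : ℝ) = e * g := by exact_mod_cast hL
  set S := (Finset.Icc 1 N).filter (fun n => L ∣ h * n) with hS
  have h1 : ∑ n ∈ S, (L : ℝ) / (h * n ^ 2) =
      ((h.gcd L : ℝ) ^ 2 / (h * L)) * ∑ n ∈ S, 1 / ((n / e : ℕ) : ℝ) ^ 2 := by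
    rw [Finset.mul_sum]
    refine Finset.sum_congr rfl fun n hn => ?_
    have hn1 := (Finset.mem_filter.mp hn)
    have n0 : (0 : ℝ) < n := by exact_mod_cast (Finset.mem_Icc.mp hn1.1).1
    rw [Nat.cast_div (hdvd n hn1.2) eR.ne', hgcd, LR]
    field_simp
  have h2 : ∑ n ∈ S, 1 / ((n / e : ℕ) : ℝ) ^ 2 ≤ Real.pi ^ 2 / 6 := by
    have hinj : Set.InjOn (fun n => n / e) (S : Set ℕ) := by
      intro a ha b hb hab
      have ha' := hdvd a (Finset.mem_filter.mp ha).2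
      have hb' := hdvd b (Finset.mem_filter.mp hb).2
      rw [← Nat.div_mul_cancel ha', ← Nat.div_mul_cancel hb']
      exact congrArg (· * e) hab
    rw [← Finset.sum_image (f := fun m : ℕ => 1 / (m : ℝ) ^ 2) hinj]
    exact sum_le_hasSum _ (fun _ _ => by positivity) hasSum_zeta_two
  rw [h1, mul_comm]
  exact mul_le_mul_of_nonneg_right h2 (by positivity)

lemma arctan_sub_le {x y : ℝ} (hx : 0 ≤ x) (hxy : x ≤ y) :
    Real.arctan y - Real.arctan x ≤ (y - x) / (1 + x ^ 2) := by
  have h1 : ∀ z ∈ Set.Icc x y, HasDerivWithinAt Real.arctan (1 / (1 + z ^ 2)) (Set.Icc x y) z :=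
    fun z _ => (Real.hasDerivAt_arctan z).hasDerivWithinAt
  have h2 : ∀ z ∈ Set.Ico x y, ‖(1 / (1 + z ^ 2) : ℝ)‖ ≤ 1 / (1 + x ^ 2) := by
    intro z hz
    rw [Real.norm_of_nonneg (by positivity)]
    have := hz.1
    gcongr
  have h3 := norm_image_sub_le_of_norm_deriv_le_segment' h1 h2 y (Set.right_mem_Icc.mpr hxy)
  refine (le_abs_self _).trans (h3.trans (le_of_eq ?_))
  ring

lemma arctan_sub_le_sum {η : ℝ} (hη : 0 ≤ η) (K : ℕ) :
    Real.arctan ((K + 1) * η) - Real.arctan η ≤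
      ∑ m ∈ Finset.range K, η / (1 + ((m + 1) * η) ^ 2) := by
  induction K with
  | zero => simp
  | succ K ih =>
    rw [Finset.sum_range_succ]
    have := arctan_sub_le (x := (K + 1) * η) (y := (K + 1 + 1) * η) (by positivity) (by nlinarith)
    rw [show ((K : ℝ) + 1 + 1) * η - (K + 1) * η = η by ring] at this
    push_cast
    linarith

lemma le_sum_poisson_dvd {A L n : ℕ} (A0 : 0 < A) (L0 : 0 < L) (n0 : 0 < n) (hn : n ∣ L) :
    (Real.arctan A - 1 / A) / n ≤
      ∑ h ∈ (Finset.Icc 1 (A ^ 2 * L)).filter (fun h => L ∣ h * n),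
        ((A * L : ℝ) * h / ((A * L : ℝ) ^ 2 + h ^ 2)) * ((L : ℝ) / (h * n ^ 2)) := by
  obtain ⟨D, rfl⟩ := hn
  have D0 : 0 < D := Nat.pos_of_mul_pos_left L0
  have AR : (0 : ℝ) < A := by exact_mod_cast A0
  have nR : (0 : ℝ) < n := by exact_mod_cast n0
  have DR : (0 : ℝ) < D := by exact_mod_cast D0
  have n1 : (1 : ℝ) ≤ n := by exact_mod_cast n0
  set f : ℕ → ℝ := fun h => ((A * (n * D : ℕ) : ℝ) * h / ((A * (n * D : ℕ) : ℝ) ^ 2 + h ^ 2)) *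
    (((n * D : ℕ) : ℝ) / (h * n ^ 2)) with hf
  have hinj : Set.InjOn (fun m => (m + 1) * D) (Finset.range (A ^ 2 * n) : Set ℕ) := by
    intro a _ b _ hab
    have := Nat.eq_of_mul_eq_mul_right D0 hab
    omega
  have hsub : (Finset.range (A ^ 2 * n)).image (fun m => (m + 1) * D) ⊆
      (Finset.Icc 1 (A ^ 2 * (n * D))).filter (fun h => n * D ∣ h * n) := by
    intro h hh
    obtain ⟨m, hm, rfl⟩ := Finset.mem_image.mp hh
    have hm' := Finset.mem_range.mp hm
    rw [Finset.mem_filter, Finset.mem_Icc]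
    refine ⟨⟨Nat.mul_pos (by omega) D0, ?_⟩, ⟨m + 1, by ring⟩⟩
    rw [← mul_assoc]
    exact Nat.mul_le_mul_right _ hm'
  have h1 := Finset.sum_le_sum_of_subset_of_nonneg (f := f) hsub
    (fun h _ _ => by simp only [hf]; positivity)
  rw [Finset.sum_image hinj] at h1
  refine le_trans ?_ h1
  set η : ℝ := 1 / (A * n) with hη
  have h2 : ∀ m : ℕ, f ((m + 1) * D) = (η / (1 + ((m + 1) * η) ^ 2)) / n := by
    intro m
    simp only [hf, hη]
    push_cast
    field_simp
  simp only [h2]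
  rw [← Finset.sum_div]
  refine div_le_div_of_nonneg_right ?_ nR.le
  have h3 := arctan_sub_le_sum (η := η) (by positivity) (A ^ 2 * n)
  have h4 : Real.arctan η ≤ 1 / A := by
    have h5 := arctan_sub_le le_rfl (show (0 : ℝ) ≤ η by positivity)
    simp only [Real.arctan_zero, sub_zero] at h5
    have h6 : η ≤ 1 / A := by
      rw [hη]; gcongr; nlinarith
    norm_num at h5
    linarith
  have h7 : Real.arctan A ≤ Real.arctan (((A ^ 2 * n : ℕ) + 1) * η) := by
    refine Real.arctan_mono ?_
    have : ((A ^ 2 * n : ℕ) : ℝ) * η = A := by rw [hη]; push_cast; field_simp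
    have : 0 < η := by positivity
    linarith
  linarith

lemma le_sum_poisson_gcd {A L N : ℕ} (A0 : 0 < A) (L0 : 0 < L)
    (hN : ∀ n ∈ Finset.Icc 1 N, n ∣ L) (hA : 0 ≤ Real.arctan A - 1 / A) :
    6 / Real.pi ^ 2 * ((Real.arctan A - 1 / A) * Real.log N) ≤
      ∑ h ∈ Finset.Icc 1 (A ^ 2 * L),
        ((A * L : ℝ) * h / ((A * L : ℝ) ^ 2 + h ^ 2)) * ((h.gcd L : ℝ) ^ 2 / (h * L)) := by
  have hlog : Real.log N ≤ ∑ n ∈ Finset.Icc 1 N, 1 / (n : ℝ) := by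
    rcases Nat.eq_zero_or_pos N with rfl | hN0
    · simp
    have h1 := log_add_one_le_harmonic N
    rw [harmonic_eq_sum_Icc] at h1
    push_cast at h1
    refine (Real.log_le_log (by exact_mod_cast hN0) (by linarith)).trans (h1.trans (le_of_eq ?_))
    simp
  have h1 : (Real.arctan A - 1 / A) * Real.log N ≤
      ∑ n ∈ Finset.Icc 1 N, ∑ h ∈ (Finset.Icc 1 (A ^ 2 * L)).filter (fun h => L ∣ h * n),
        ((A * L : ℝ) * h / ((A * L : ℝ) ^ 2 + h ^ 2)) * ((L : ℝ) / (h * n ^ 2)) := by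
    refine (mul_le_mul_of_nonneg_left hlog hA).trans ?_
    rw [Finset.mul_sum]
    refine Finset.sum_le_sum fun n hn => ?_
    rw [mul_one_div]
    exact le_sum_poisson_dvd A0 L0 (Finset.mem_Icc.mp hn).1 (hN n hn)
  have h2 : ∑ n ∈ Finset.Icc 1 N, ∑ h ∈ (Finset.Icc 1 (A ^ 2 * L)).filter (fun h => L ∣ h * n),
        ((A * L : ℝ) * h / ((A * L : ℝ) ^ 2 + h ^ 2)) * ((L : ℝ) / (h * n ^ 2)) =
      ∑ h ∈ Finset.Icc 1 (A ^ 2 * L), ((A * L : ℝ) * h / ((A * L : ℝ) ^ 2 + h ^ 2)) *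
        ∑ n ∈ (Finset.Icc 1 N).filter (fun n => L ∣ h * n), ((L : ℝ) / (h * n ^ 2)) := by
    simp only [Finset.sum_filter, Finset.mul_sum]
    rw [Finset.sum_comm]
    refine Finset.sum_congr rfl fun h _ => Finset.sum_congr rfl fun n _ => ?_
    split_ifs <;> simp
  rw [h2] at h1
  have h3 := h1.trans (Finset.sum_le_sum fun h hh => mul_le_mul_of_nonneg_left
    (sum_inv_sq_filter_dvd_le (Finset.mem_Icc.mp hh).1 L0 N) (by positivity))
  have hpi := Real.pi_pos
  refine (mul_le_mul_of_nonneg_left h3 (by positivity)).trans (le_of_eq ?_)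
  rw [Finset.mul_sum]
  refine Finset.sum_congr rfl fun h _ => ?_
  field_simp

lemma le_sum_sum_natDist {J H : ℕ} (v : ℕ → ℝ) (hv : ∀ n, 0 ≤ v n) :
    ((J : ℝ) - 2 * H) * (2 * ∑ h ∈ Finset.Icc 1 H, v h) ≤
      ∑ k ∈ Finset.range J, ∑ l ∈ Finset.range J, v (Nat.dist k l) := by
  have hV : 0 ≤ ∑ h ∈ Finset.Icc 1 H, v h := Finset.sum_nonneg fun _ _ => hv _
  have hIcc : ∑ h ∈ Finset.Icc 1 H, v h = ∑ i ∈ Finset.range H, v (i + 1) := by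
    rw [Finset.range_eq_Ico, Finset.sum_Ico_add' v 0 H 1]; rfl
  have h1 : ∀ k ∈ Finset.Ico H (J - H), 2 * ∑ h ∈ Finset.Icc 1 H, v h ≤
      ∑ l ∈ Finset.range J, v (Nat.dist k l) := by
    intro k hk
    obtain ⟨hk1, hk2⟩ := Finset.mem_Ico.mp hk
    have hdisj : Disjoint (Finset.Ico (k - H) k) (Finset.Ico (k + 1) (k + 1 + H)) := by
      rw [Finset.disjoint_left]; intro x hx hx'
      simp only [Finset.mem_Ico] at hx hx'; omega
    have hsub : Finset.Ico (k - H) k ∪ Finset.Ico (k + 1) (k + 1 + H) ⊆ Finset.range J := by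
      intro x hx
      simp only [Finset.mem_union, Finset.mem_Ico, Finset.mem_range] at hx ⊢; omega
    refine le_trans (le_of_eq ?_) (Finset.sum_le_sum_of_subset_of_nonneg hsub fun _ _ _ => hv _)
    rw [Finset.sum_union hdisj, Finset.sum_Ico_eq_sum_range, Finset.sum_Ico_eq_sum_range,
      show k - (k - H) = H by omega, show k + 1 + H - (k + 1) = H by omega, two_mul]
    congr 1
    · rw [hIcc, ← Finset.sum_range_reflect]
      refine Finset.sum_congr rfl fun i hi => ?_
      have := Finset.mem_range.mp hi
      congr 1; simp only [Nat.dist]; omega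
    · rw [hIcc]
      refine Finset.sum_congr rfl fun i _ => ?_
      congr 1; simp only [Nat.dist]; omega
  have hsub : Finset.Ico H (J - H) ⊆ Finset.range J := by
    intro x hx
    simp only [Finset.mem_Ico, Finset.mem_range] at hx ⊢; omega
  refine le_trans ?_ (Finset.sum_le_sum_of_subset_of_nonneg hsub fun _ _ _ =>
    Finset.sum_nonneg fun _ _ => hv _)
  refine le_trans ?_ (Finset.sum_le_sum h1)
  rw [Finset.sum_const, Nat.card_Ico, nsmul_eq_mul]
  refine mul_le_mul_of_nonneg_right ?_ (by linarith)
  have : (J : ℝ) ≤ ((J - H - H : ℕ) : ℝ) + 2 * H := by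
    have : J ≤ (J - H - H) + 2 * H := by omega
    exact_mod_cast this
  linarith

lemma le_dedekindMod_mul_poisson {q : ℕ} [hq : Fact q.Prime] {L J : ℕ} (L0 : 0 < L) (hLJ : L < J)
    (hJ : J ≤ q) {c : ℝ} (hc : 0 < c) {k l : ℕ} (hk : k < J) (hl : l < J) :
    q * ((c * Nat.dist k l / (c ^ 2 + (Nat.dist k l : ℝ) ^ 2)) *
        (((Nat.dist k l).gcd L : ℝ) ^ 2 / (Nat.dist k l * L))) / 12 - 2 * J ≤
      dedekindMod q (((l : ZMod q) - k) / L) *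
        (c * ((l : ℝ) - k) / (c ^ 2 + ((l : ℝ) - k) ^ 2)) := by
  have key : ∀ h : ℕ, h < J →
      q * ((c * h / (c ^ 2 + (h : ℝ) ^ 2)) * ((h.gcd L : ℝ) ^ 2 / (h * L))) / 12 - 2 * J ≤
      dedekindMod q ((h : ZMod q) / L) * (c * h / (c ^ 2 + (h : ℝ) ^ 2)) := by
    intro h hh
    rcases Nat.eq_zero_or_pos h with rfl | h0
    · simp
    have h1 := le_dedekindMod_div (q := q) h0 (by omega) L0 (by omega)
    have hw0 : 0 ≤ c * h / (c ^ 2 + (h : ℝ) ^ 2) := by positivity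
    have hw1 : c * h / (c ^ 2 + (h : ℝ) ^ 2) ≤ 1 := by
      rw [div_le_one (by positivity)]; nlinarith [sq_nonneg (c - h), sq_nonneg (c + h)]
    have hJ2 : (h + L + 1 : ℝ) ≤ 2 * J := by
      have : h + L + 1 ≤ 2 * J := by omega
      exact_mod_cast this
    have h2 := mul_le_mul_of_nonneg_right h1 hw0
    have h3 := mul_le_mul hJ2 hw1 hw0 (by positivity)
    have e : (h.gcd L : ℝ) ^ 2 / (12 * h * L) = (h.gcd L : ℝ) ^ 2 / (h * L) / 12 := by
      rw [div_div]; ring_nf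
    rw [e] at h2
    linarith
  rcases le_total k l with hkl | hkl
  · obtain ⟨h, rfl⟩ := Nat.exists_eq_add_of_le hkl
    have hd : Nat.dist k (k + h) = h := by simp only [Nat.dist]; omega
    rw [hd]
    have := key h (by omega)
    push_cast
    simpa using this
  · obtain ⟨h, rfl⟩ := Nat.exists_eq_add_of_le hkl
    have hd : Nat.dist (l + h) l = h := by simp only [Nat.dist]; omega
    rw [hd]
    have := key h (by omega)
    have e1 : ((l : ZMod q) - ((l + h : ℕ) : ZMod q)) / L = -((h : ZMod q) / L) := by
      push_cast; ring
    have e2 : (l : ℝ) - ((l + h : ℕ) : ℝ) = -h := by push_cast; ring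
    rw [e1, e2, dedekindMod_neg]
    refine this.trans (le_of_eq ?_)
    rw [neg_sq]; ring

lemma log_le_of_forall_re_le {q : ℕ} [hq : Fact q.Prime] {A L N : ℕ} (A2 : 2 ≤ A) (L0 : 0 < L)
    (hN : ∀ n ∈ Finset.Icc 1 N, n ∣ L) (hA : 0 ≤ Real.arctan A - 1 / A)
    (hJ : A ^ 3 * L ≤ q) {M : ℝ} (hM : ∀ t : ℤ, ((Real.pi : ℂ) * I * shat q t).re ≤ M) :
    (1 - 2 / A) * (Real.arctan A - 1 / A) / Real.pi * Real.log N -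
      2 * Real.pi * (A ^ 3 * L) ^ 2 / q ≤ M := by
  have hLJ : L < A ^ 3 * L := by
    have : 2 ^ 3 ≤ A ^ 3 := Nat.pow_le_pow_left A2 3
    nlinarith
  set J := A ^ 3 * L with hJdef
  have hL : (L : ZMod q) ≠ 0 := by
    rw [Ne, ZMod.natCast_eq_zero_iff]
    exact fun hd => absurd (Nat.le_of_dvd L0 hd) (by omega)
  have AR : (0 : ℝ) < A := by exact_mod_cast (by omega : 0 < A)
  have A2R : (2 : ℝ) ≤ A := by exact_mod_cast A2
  have LR : (0 : ℝ) < L := by exact_mod_cast L0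
  have qR : (0 : ℝ) < q := by exact_mod_cast hq.out.pos
  have hpi := Real.pi_pos
  have hc : (0 : ℝ) < A * L := by positivity
  have h1 := sum_poisson_le_of_sum_sin_le (Finset.range J ×ˢ Finset.range J)
    (fun p => dedekindMod q (((p.2 : ZMod q) - p.1) / L)) (fun p => (p.2 : ℝ) - p.1)
    (C := M * q * J / Real.pi) (by
      intro φ
      rw [Finset.sum_product]
      exact sum_sin_mul_dedekindMod_le hL hJ hM φ) hc
  rw [Finset.sum_product] at h1
  set v : ℕ → ℝ := fun h => q * ((A * L * h / ((A * L : ℝ) ^ 2 + (h : ℝ) ^ 2)) *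
    ((h.gcd L : ℝ) ^ 2 / (h * L))) / 12 with hv
  have h2 : ∑ k ∈ Finset.range J, ∑ l ∈ Finset.range J, (v (Nat.dist k l) - 2 * J) ≤
      M * q * J / Real.pi := by
    refine le_trans (Finset.sum_le_sum fun k hk => Finset.sum_le_sum fun l hl => ?_) h1
    exact le_dedekindMod_mul_poisson L0 hLJ hJ hc (Finset.mem_range.mp hk) (Finset.mem_range.mp hl)
  simp only [Finset.sum_sub_distrib, Finset.sum_const, Finset.card_range, nsmul_eq_mul] at h2
  have h3 := le_sum_sum_natDist (J := J) (H := A ^ 2 * L) v (fun n => by simp only [hv]; positivity)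
  have h4 := le_sum_poisson_gcd (by omega) L0 hN hA
  have h5 : ∑ h ∈ Finset.Icc 1 (A ^ 2 * L), v h = q / 12 * ∑ h ∈ Finset.Icc 1 (A ^ 2 * L),
        ((A * L : ℝ) * h / ((A * L : ℝ) ^ 2 + h ^ 2)) * ((h.gcd L : ℝ) ^ 2 / (h * L)) := by
    rw [Finset.mul_sum]
    exact Finset.sum_congr rfl fun h _ => by simp only [hv]; ring
  rw [h5] at h3
  have hJR : (J : ℝ) = A ^ 3 * L := by rw [hJdef]; push_cast; ring
  have hJpos : (0 : ℝ) < J := by rw [hJR]; positivity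
  have h6 : (J : ℝ) - 2 * ((A ^ 2 * L : ℕ) : ℝ) = J * (1 - 2 / A) := by
    rw [hJR]; push_cast; field_simp
  have h7 : 0 ≤ 1 - 2 / (A : ℝ) := by
    rw [sub_nonneg, div_le_one AR]; exact A2R
  rw [h6] at h3
  have h8 : J * (1 - 2 / A) * (2 * (q / 12 *
      (6 / Real.pi ^ 2 * ((Real.arctan A - 1 / A) * Real.log N)))) ≤
      M * q * J / Real.pi + J * (J * (2 * J)) := by
    refine le_trans ?_ (le_trans h3 (by linarith))
    gcongr
  have h9 := mul_le_mul_of_nonneg_left h8 (show 0 ≤ Real.pi / (q * J) by positivity)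
  have e1 : Real.pi / (q * J) * (J * (1 - 2 / A) * (2 * (q / 12 *
      (6 / Real.pi ^ 2 * ((Real.arctan A - 1 / A) * Real.log N))))) =
      (1 - 2 / A) * (Real.arctan A - 1 / A) / Real.pi * Real.log N := by
    generalize (Real.arctan A - 1 / A) = z
    generalize (1 - 2 / (A : ℝ)) = w
    field_simp; ring
  have e2 : Real.pi / (q * J) * (M * q * J / Real.pi + J * (J * (2 * J))) =
      M + 2 * Real.pi * J ^ 2 / q := by
    field_simp
  rw [e1, e2] at h9
  rw [hJR] at h9
  linarith

lemma exists_nat_arctan_ratio {c : ℝ} (hc : c < 1 / 2) : ∃ A : ℕ, 2 ≤ A ∧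
    0 ≤ Real.arctan A - 1 / A ∧ c ≤ (1 - 2 / A) * (Real.arctan A - 1 / A) / Real.pi := by
  have hcast := tendsto_natCast_atTop_atTop (R := ℝ)
  have hinv : ∀ b : ℝ, Filter.Tendsto (fun n : ℕ => b / (n : ℝ)) Filter.atTop (nhds 0) :=
    fun b => tendsto_const_nhds.div_atTop hcast
  have hat : Filter.Tendsto (fun n : ℕ => Real.arctan n) Filter.atTop (nhds (Real.pi / 2)) :=
    (Real.tendsto_arctan_atTop.mono_right nhdsWithin_le_nhds).comp hcast
  have h1 := hat.sub (hinv 1)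
  have h2 := ((((hinv 2).const_sub 1).mul h1).div_const Real.pi)
  have hpi := Real.pi_pos
  have e1 : (1 - 0) * (Real.pi / 2 - 0) / Real.pi = 1 / 2 := by field_simp; ring
  rw [e1] at h2
  rw [sub_zero] at h1
  obtain ⟨A, hA1, hA2, hA3⟩ := ((h1.eventually_const_le (show 0 < Real.pi / 2 by positivity)).and
    ((h2.eventually_const_le hc).and (Filter.eventually_ge_atTop 2))).exists
  exact ⟨A, hA3, hA1, hA2⟩

lemma eventually_factorial_le (C : ℝ) : ∀ᶠ x : ℝ in Filter.atTop, ∃ N : ℕ,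
    0.99 * Real.log x ≤ Real.log N ∧ C * (N.factorial : ℝ) ^ 2 ≤ Real.exp x := by
  have h1 : ∀ᶠ x : ℝ in Filter.atTop, ‖Real.log x‖ ≤ (1 / 32) * ‖x ^ (0.01 : ℝ)‖ :=
    (isLittleO_log_rpow_atTop (by norm_num : (0 : ℝ) < 0.01)).bound (by norm_num)
  have h2 : ∀ᶠ x : ℝ in Filter.atTop, C ≤ Real.exp (x / 2) :=
    (Real.tendsto_exp_atTop.comp
      (Filter.tendsto_id.atTop_div_const (by norm_num : (0 : ℝ) < 2))).eventually_ge_atTop C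
  filter_upwards [h1, h2, Filter.eventually_ge_atTop 2] with x hx1 hx2 hx3
  have x0 : 0 < x := by linarith
  have hlog : 0 ≤ Real.log x := Real.log_nonneg (by linarith)
  have hpow1 : 1 ≤ x ^ (0.99 : ℝ) := Real.one_le_rpow (by linarith) (by norm_num)
  rw [Real.norm_of_nonneg hlog, Real.norm_of_nonneg (by positivity)] at hx1
  refine ⟨⌈x ^ (0.99 : ℝ)⌉₊, ?_, ?_⟩
  · rw [← Real.log_rpow x0]
    exact Real.log_le_log (by positivity) (Nat.le_ceil _)
  · set N := ⌈x ^ (0.99 : ℝ)⌉₊ with hN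
    have hNle : (N : ℝ) ≤ 2 * x ^ (0.99 : ℝ) := by
      have : (N : ℝ) < x ^ (0.99 : ℝ) + 1 := Nat.ceil_lt_add_one (by positivity)
      linarith
    have hNge : (1 : ℝ) ≤ N := hpow1.trans (Nat.le_ceil _)
    have hlogN : Real.log N ≤ 2 * Real.log x := by
      refine (Real.log_le_log (by linarith) hNle).trans ?_
      rw [Real.log_mul (by norm_num) (by positivity), Real.log_rpow x0]
      have := Real.log_le_log (by norm_num) hx3
      linarith
    have hmul : (N : ℝ) * Real.log N ≤ x / 8 := by
      calc (N : ℝ) * Real.log N ≤ (2 * x ^ (0.99 : ℝ)) * (2 * ((1 / 32) * x ^ (0.01 : ℝ))) := by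
            refine mul_le_mul hNle (by linarith) (Real.log_nonneg hNge) (by positivity)
        _ = (x ^ (0.99 : ℝ) * x ^ (0.01 : ℝ)) / 8 := by ring
        _ = x / 8 := by rw [← Real.rpow_add x0]; norm_num
    have hfac : (N.factorial : ℝ) ≤ Real.exp (x / 8) := by
      calc (N.factorial : ℝ) ≤ (N : ℝ) ^ N := by exact_mod_cast Nat.factorial_le_pow N
        _ = Real.exp (N * Real.log N) := by
            rw [mul_comm, Real.exp_mul, Real.exp_log (by linarith), Real.rpow_natCast]
        _ ≤ _ := Real.exp_le_exp.mpr hmul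
    calc C * (N.factorial : ℝ) ^ 2 ≤ Real.exp (x / 2) * Real.exp (x / 8) ^ 2 := by gcongr
      _ = Real.exp (x / 2 + 2 * (x / 8)) := by
          rw [Real.exp_add, ← Real.exp_nat_mul]; norm_num
      _ ≤ Real.exp x := Real.exp_le_exp.mpr (by linarith)

lemma shat_emod {q : ℕ} [NeZero q] (t : ℤ) : shat q (t % q) = shat q t := by
  rw [shat_eq_sum_zmod, shat_eq_sum_zmod]; simp

lemma exp_eulerMascheroni_div_four_lt : Real.exp Real.eulerMascheroniConstant / 4 < 0.488 := by
  have h1 := Real.exp_lt_exp.mpr Real.eulerMascheroniConstant_lt_two_thirds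
  have h2 : Real.exp (2 / 3) ^ 3 = Real.exp 1 ^ 2 := by
    rw [← Real.exp_nat_mul, ← Real.exp_nat_mul]; norm_num
  have h3 := Real.exp_one_lt_d9
  have h4 := Real.exp_pos 1
  have h5 : Real.exp (2 / 3) < 1.952 := by
    refine lt_of_pow_lt_pow_left₀ 3 (by norm_num) ?_
    rw [h2]; nlinarith
  linarith

lemma eventually_exists_le_re_shat : ∃ q₀ : ℕ, ∀ q : ℕ, q.Prime → q₀ ≤ q →
    0 ≤ Real.log (Real.log q) ∧ ∃ t : ℤ, 1 ≤ t ∧ t ≤ (q : ℤ) - 1 ∧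
      0.488 * Real.log (Real.log q) ≤ ((Real.pi : ℂ) * Complex.I * shat q t).re := by
  obtain ⟨A, hA2, hA0, hA⟩ := exists_nat_arctan_ratio (show (0.495 : ℝ) < 1 / 2 by norm_num)
  have hlogq : Filter.Tendsto (fun q : ℕ => Real.log q) Filter.atTop Filter.atTop :=
    Real.tendsto_log_atTop.comp tendsto_natCast_atTop_atTop
  have h1 := hlogq.eventually (eventually_factorial_le (2 * Real.pi * (A ^ 3) ^ 2))
  have h2 := (Real.tendsto_log_atTop.comp hlogq).eventually_ge_atTop 1000
  obtain ⟨q₀, hq₀⟩ := Filter.eventually_atTop.mp (h1.and h2)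
  refine ⟨q₀, fun q hq hqq => ?_⟩
  obtain ⟨⟨N, hN1, hN2⟩, hlog⟩ := hq₀ q hqq
  simp only [Function.comp] at hlog
  refine ⟨by linarith, ?_⟩
  by_contra! hcon
  have : Fact q.Prime := ⟨hq⟩
  have qR : (0 : ℝ) < q := by exact_mod_cast hq.pos
  rw [Real.exp_log qR] at hN2
  have hM : ∀ t : ℤ, ((Real.pi : ℂ) * I * shat q t).re ≤ 0.488 * Real.log (Real.log q) := by
    intro t
    rw [← shat_emod t]
    have hq0 : (0 : ℤ) < q := by exact_mod_cast hq.pos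
    rcases (Int.emod_nonneg t hq0.ne').eq_or_lt with h0 | h0
    · have h3 := shat_neg (q := q) 0
      rw [neg_zero, self_eq_neg] at h3
      rw [← h0, h3]; simp; linarith
    · exact (hcon _ h0 (by have := Int.emod_lt_of_pos t hq0; omega)).le
  have hfac : (1 : ℝ) ≤ N.factorial := by exact_mod_cast Nat.factorial_pos N
  have hAR : (1 : ℝ) ≤ A ^ 3 := one_le_pow₀ (by exact_mod_cast (by omega : 1 ≤ A))
  have hpi := Real.pi_gt_three
  have hJ1 : (1 : ℝ) ≤ A ^ 3 * N.factorial := one_le_mul_of_one_le_of_one_le hAR hfac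
  have hJ : A ^ 3 * N.factorial ≤ q := by
    have : (A ^ 3 * N.factorial : ℝ) ≤ q := by
      have h3 : (A ^ 3 * N.factorial : ℝ) ≤ (A ^ 3 * N.factorial) ^ 2 :=
        le_self_pow₀ hJ1 (by norm_num)
      have h4 : 1 * (A ^ 3 * N.factorial : ℝ) ^ 2 ≤ 2 * Real.pi * (A ^ 3 * N.factorial) ^ 2 :=
        mul_le_mul_of_nonneg_right (by linarith) (by positivity)
      linarith
    exact_mod_cast this
  have h4 := log_le_of_forall_re_le hA2 (Nat.factorial_pos N) (N := N)
    (fun n hn => Nat.dvd_factorial (Finset.mem_Icc.mp hn).1 (Finset.mem_Icc.mp hn).2) hA0 hJ hM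
  have h5 : 2 * Real.pi * (A ^ 3 * N.factorial) ^ 2 / q ≤ (1 : ℝ) := by
    rw [div_le_one qR]; nlinarith
  have h6 : 0.495 * Real.log N ≤
      (1 - 2 / A) * (Real.arctan A - 1 / A) / Real.pi * Real.log N :=
    mul_le_mul_of_nonneg_right hA (by linarith)
  linarith

/-- Existence of large values of `πi·ŝ_q(t)` (Theorem 2, part 3). -/
theorem exists_large_value_dedekind_fourier :
    ∀ ε : ℝ, 0 < ε → ∃ q₀ : ℕ, ∀ q : ℕ, q.Prime → q₀ ≤ q →
    ∃ t : ℤ, 1 ≤ t ∧ t ≤ (q : ℤ) - 1 ∧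
      -((Real.pi : ℂ) * Complex.I * shat q (-t)) = (Real.pi : ℂ) * Complex.I * shat q t ∧
      (Real.exp Real.eulerMascheroniConstant / 4 - ε) * Real.log (Real.log q) ≤
        ((Real.pi : ℂ) * Complex.I * shat q t).re := by
  intro ε hε
  obtain ⟨q₀, h⟩ := eventually_exists_le_re_shat
  refine ⟨q₀, fun q hq hqq => ?_⟩
  obtain ⟨hlog, t, ht1, ht2, ht⟩ := h q hq hqq
  have : NeZero q := ⟨hq.ne_zero⟩
  refine ⟨t, ht1, ht2, by rw [shat_neg]; ring, le_trans ?_ ht⟩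
  have := exp_eulerMascheroni_div_four_lt
  exact mul_le_mul_of_nonneg_right (by linarith) hlog
end
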